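/- arXiv:0904.2257 — 3 statements merged into one kernel-verified Lean document; each statement's English description precedes it below -/
import Mathlib

section
/- Let X be an alphabet having n letters and let g: X* → X* be a primitive morphism. Assume that x ∈ X is a letter, k is a positive integer, and (g^k)^ω(x) = u^ω, where u ∈ X* is a primitive word. Then |g^{2n}(z)| ≥ 2|u| for all letters z ∈ X. -/
open Filter Set

variable {X : Type*}

/-- Apply the morphism with letter images `g` to a word. -/
def applyM (g : X → List X) (w : List X) : List X := w.flatMap g

/-- `iterM g k w` is `g^k(w)`. -/
def iterM (g : X → List X) (k : ℕ) (w : List X) : List X := (applyM g)^[k] w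

/-- The letter map of the composition `g ∘ h` (first `h`, then `g`). -/
def compM (g h : X → List X) : X → List X := fun a => applyM g (h a)

/-- The letter map of the power `g^k`. -/
def powM (g : X → List X) (k : ℕ) : X → List X := fun a => iterM g k [a]

/-- A morphism is primitive if some power maps every letter to a word containing every letter. -/
def Primitive (g : X → List X) : Prop := ∃ k : ℕ, 0 < k ∧ ∀ a b : X, a ∈ iterM g k [b]

/-- `Mg g` is the maximal length of the image of a letter. -/
def Mg [Fintype X] (g : X → List X) : ℕ := Finset.univ.sup fun x => (g x).length

/-- A morphism is growing if the lengths of iterated images of every letter tend to infinity. -/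
def Growing (g : X → List X) : Prop :=
  ∀ x : X, Tendsto (fun i => (iterM g i [x]).length) atTop atTop

/-- `w` is a (finite) prefix of the infinite word `s`. -/
def IsPrefI (w : List X) (s : ℕ → X) : Prop := ∀ i (h : i < w.length), w[i]'h = s i

/-- `v` is a factor of the infinite word `s`. -/
def IsFactorI (v : List X) (s : ℕ → X) : Prop :=
  ∃ j : ℕ, ∀ i (h : i < v.length), v[i]'h = s (j + i)

/-- `g^ω(x)` exists. -/
def OmegaExists (g : X → List X) (x : X) : Prop :=
  [x] <+: g x ∧ Tendsto (fun i => (iterM g i [x]).length) atTop atTop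

/-- `s = g^ω(x)`. -/
def IsOmega (g : X → List X) (x : X) (s : ℕ → X) : Prop :=
  OmegaExists g x ∧ ∀ i : ℕ, IsPrefI (iterM g i [x]) s

/-- `s = u^ω` for the nonempty word `u`. -/
def IsPeriodicWord (s : ℕ → X) (u : List X) : Prop :=
  u ≠ [] ∧ ∀ (i : ℕ) (h : i % u.length < u.length), s i = u[i % u.length]'h

/-- A morphism is looping. -/
def Looping (g : X → List X) : Prop :=
  ∃ k : ℕ, 0 < k ∧ ∃ x : X, ∃ u : List X, ∃ s : ℕ → X,
    IsOmega (powM g k) x s ∧ IsPeriodicWord s u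

/-- A morphism is loop-free if it is not looping. -/
def LoopFree (g : X → List X) : Prop := ¬ Looping g

/-- `p` is a period of `u`. -/
def HasPeriod (u : List X) (p : ℕ) : Prop :=
  0 < p ∧ ∀ i : ℕ, i + p < u.length → u[i + p]? = u[i]?

/-- The smallest period of `u`. -/
noncomputable def PER (u : List X) : ℕ := sInf {p | HasPeriod u p}

/-- A primitive word: nonempty and not a proper power of a shorter word. -/
def PrimitiveWord (u : List X) : Prop :=
  u ≠ [] ∧ ¬∃ (v : List X) (j : ℕ), 2 ≤ j ∧ v.length < u.length ∧
    u = (List.replicate j v).flatten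

/-- `COMP g h` : the set of words whose images under `g` and `h` are prefix-comparable. -/
def COMP (g h : X → List X) : Set (List X) :=
  {w | ∃ u₁ u₂ : List X, applyM g w ++ u₁ = applyM h w ++ u₂}

/-- `BAL g h`. -/
noncomputable def BAL (g h : X → List X) : ℕ∞ :=
  ⨆ (x : X) (k : ℕ),
    ((((applyM g (iterM g k [x])).length : ℤ) -
      ((applyM h (iterM g k [x])).length : ℤ)).natAbs : ℕ∞)

/-- The set of factors of length `q` of the word `w`. -/
def Fq (q : ℕ) (w : List X) : Set (List X) := {v | v.length = q ∧ v <:+: w}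

/-- The set of factors of length `q` of words of `L`. -/
def FqL (q : ℕ) (L : Set (List X)) : Set (List X) := ⋃ w ∈ L, Fq q w

/-- `A n = ⌊9 n³ √(n log n)⌋`. -/
noncomputable def Abound (n : ℕ) : ℕ := ⌊9 * (n : ℝ)^3 * Real.sqrt (n * Real.log n)⌋₊

namespace PLB

universe u v w

def fac {A : Type u} (s : ℕ → A) (a l : ℕ) : List A := (List.range l).map (fun k => s (a + k))

@[simp] lemma fac_length {A : Type u} (s : ℕ → A) (a l : ℕ) : (fac s a l).length = l := by
  simp [fac]

lemma fac_add {A : Type u} (s : ℕ → A) (a l m : ℕ) :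
    fac s a (l + m) = fac s a l ++ fac s (a + l) m := by
  simp [fac, List.range_add, Function.comp_def, Nat.add_assoc]

lemma fac_one {A : Type u} (s : ℕ → A) (a : ℕ) : fac s a 1 = [s a] := by
  simp [fac]

lemma fac_zero {A : Type u} (s : ℕ → A) (a : ℕ) : fac s a 0 = [] := by
  simp [fac]

lemma fac_eq_iff {A : Type u} (s t : ℕ → A) (a b l : ℕ) :
    fac s a l = fac t b l ↔ ∀ k < l, s (a + k) = t (b + k) := by
  simp [fac]

def NE {A : Type u} {B : Type v} (g : A → List B) : Prop := ∀ x, g x ≠ []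

lemma NE.pos {A : Type u} {B : Type v} {g : A → List B} (hg : NE g) (x : A) :
    1 ≤ (g x).length := List.length_pos_iff.mpr (hg x)

lemma NE.length_le {A : Type u} {B : Type v} {g : A → List B} (hg : NE g) (w : List A) :
    w.length ≤ (w.flatMap g).length := by
  induction w with
  | nil => simp
  | cons x w ih =>
    have := hg.pos x
    simp only [List.flatMap_cons, List.length_append, List.length_cons]
    omega

/-- `t` from position `Φ 0` on is `g(s)`, with cut points `Φ`. -/
def Img {A : Type u} {B : Type v} (g : A → List B) (s : ℕ → A) (Φ : ℕ → ℕ) (t : ℕ → B) : Prop :=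
  ∀ i, Φ (i + 1) = Φ i + (g (s i)).length ∧ g (s i) = fac t (Φ i) (g (s i)).length

lemma Img.fac {A : Type u} {B : Type v} {g : A → List B} {s : ℕ → A} {Φ : ℕ → ℕ} {t : ℕ → B}
    (h : Img g s Φ t) (a l : ℕ) :
    Φ (a + l) = Φ a + ((fac s a l).flatMap g).length ∧
      (fac s a l).flatMap g = fac t (Φ a) ((fac s a l).flatMap g).length := by
  induction l with
  | zero => simp [fac_zero]
  | succ l ih =>
    obtain ⟨i1, i2⟩ := ih
    obtain ⟨h1, h2⟩ := h (a + l)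
    rw [fac_add, fac_one, List.flatMap_append]
    simp only [List.flatMap_singleton, List.length_append]
    refine ⟨by rw [← Nat.add_assoc, h1, i1, Nat.add_assoc], ?_⟩
    rw [fac_add, ← i2, ← i1, ← h2]

lemma Img.comp {A : Type u} {B : Type v} {C : Type w} {f : A → List B} {g : B → List C}
    {s : ℕ → A} {t : ℕ → B} {r : ℕ → C} {Φ Ψ : ℕ → ℕ}
    (hf : Img f s Φ t) (hg : Img g t Ψ r) :
    Img (fun x => (f x).flatMap g) s (fun i => Ψ (Φ i)) r := by
  intro i
  obtain ⟨h1, h2⟩ := hf i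
  have := hg.fac (Φ i) (f (s i)).length
  rw [← h2] at this
  simpa [h1] using this

def Expd (Φ : ℕ → ℕ) : Prop := ∀ a l, Φ a + l ≤ Φ (a + l)

lemma Img.expd {A : Type u} {B : Type v} {g : A → List B} {s : ℕ → A} {Φ : ℕ → ℕ} {t : ℕ → B}
    (h : Img g s Φ t) (hg : NE g) : Expd Φ := by
  intro a l
  have h1 := (h.fac a l).1
  have h2 := hg.length_le (PLB.fac s a l)
  simp only [fac_length] at h2
  omega

lemma Expd.le {Φ : ℕ → ℕ} (h : Expd Φ) {a b c : ℕ} (hab : a + c ≤ b) : Φ a + c ≤ Φ b := by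
  have := h a (b - a)
  rw [Nat.add_sub_cancel' (by omega)] at this
  omega

lemma Expd.iterate {Φ : ℕ → ℕ} (h : Expd Φ) (j : ℕ) : Expd Φ^[j] := by
  induction j with
  | zero => intro a l; simp
  | succ j ih =>
    intro a l
    rw [Function.iterate_succ_apply', Function.iterate_succ_apply']
    exact h.le (ih a l)

lemma Img.shift {A : Type u} {B : Type v} {g : A → List B} {s : ℕ → A} {Φ : ℕ → ℕ} {t : ℕ → B}
    (h : Img g s Φ t) (hg : NE g) {a b : ℕ} (hab : ∀ k, s (a + k) = s (b + k)) :
    (∀ l, Φ (a + l) + Φ b = Φ (b + l) + Φ a) ∧ ∀ k, t (Φ a + k) = t (Φ b + k) := by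
  have key : ∀ l, PLB.fac s a l = PLB.fac s b l := fun l => (fac_eq_iff _ _ _ _ _).2 fun k _ => hab k
  constructor
  · intro l
    have h1 := (h.fac a l).1
    have h2 := (h.fac b l).1
    rw [key] at h1
    omega
  · intro k
    have h1 := (h.fac a (k+1)).2
    have h2 := (h.fac b (k+1)).2
    rw [key, h2] at h1
    simp only [fac_length] at h1
    refine ((fac_eq_iff _ _ _ _ _).1 h1 k ?_).symm
    have := hg.length_le (PLB.fac s b (k+1))
    simp only [fac_length] at this
    omega

def Per {A : Type u} (s : ℕ → A) (p : ℕ) : Prop :=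
  0 < p ∧ ∀ a b, (∀ k, s (a + k) = s (b + k)) ↔ a ≡ b [MOD p]

lemma exists_per {A : Type u} (s : ℕ → A) (P : ℕ) (hP : 0 < P) (h : ∀ i, s (i + P) = s i) :
    ∃ p, Per s p ∧ p ∣ P := by
  classical
  have hex : ∃ p, 0 < p ∧ ∀ i, s (i + p) = s i := ⟨P, hP, h⟩
  obtain ⟨h1, h2⟩ := Nat.find_spec hex
  have hmin : ∀ q, q < Nat.find hex → ¬ (0 < q ∧ ∀ i, s (i + q) = s i) :=
    fun q hq => Nat.find_min hex hq
  generalize Nat.find hex = p at *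
  have mulp : ∀ j i, s (i + p * j) = s i := by
    intro j
    induction j with
    | zero => simp
    | succ j ih => intro i; rw [Nat.mul_succ, ← Nat.add_assoc, h2, ih]
  have mulP : ∀ j i, s (i + P * j) = s i := by
    intro j
    induction j with
    | zero => simp
    | succ j ih => intro i; rw [Nat.mul_succ, ← Nat.add_assoc, h, ih]
  have dv : ∀ q, (∀ i, s (i + q) = s i) → p ∣ q := by
    intro q hq
    by_contra hc
    apply hmin (q % p) (Nat.mod_lt _ h1)
    refine ⟨Nat.pos_of_ne_zero fun h0 => hc (Nat.dvd_of_mod_eq_zero h0), fun i => ?_⟩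
    rw [← mulp (q / p), Nat.add_assoc, Nat.mod_add_div, hq]
  have main : ∀ a b, a ≤ b → (∀ k, s (a + k) = s (b + k)) → a ≡ b [MOD p] := by
    intro a b hab hk
    rw [Nat.modEq_iff_dvd' hab]
    apply dv
    intro i
    have h3 := hk (i + P * a - a)
    have h4 : a ≤ P * a := Nat.le_mul_of_pos_left _ hP
    rw [show a + (i + P * a - a) = i + P * a by omega,
      show b + (i + P * a - a) = (i + (b - a)) + P * a by omega, mulP, mulP] at h3
    exact h3.symm
  refine ⟨p, ⟨h1, fun a b => ⟨fun hk => ?_, fun hm => ?_⟩⟩, dv P h⟩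
  · rcases le_total a b with hab | hab
    · exact main a b hab hk
    · exact (main b a hab fun k => (hk k).symm).symm
  · have aux : ∀ a b, a ≤ b → a ≡ b [MOD p] → ∀ k, s (a + k) = s (b + k) := by
      intro a b hab hm k
      rw [Nat.modEq_iff_dvd' hab] at hm
      obtain ⟨j, hj⟩ := hm
      rw [show b + k = (a + k) + p * j by omega, mulp]
    rcases le_total a b with hab | hab
    · exact aux a b hab hm
    · exact fun k => (aux b a hab hm.symm k).symm

/-- Defect lemma. -/
lemma defect {A : Type u} {B : Type v} [Fintype A] : ∀ (S : ℕ) (g : A → List B), NE g →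
    (∑ x, (g x).length) ≤ S → ∀ (a b : A) (t t' : List A) (v1 v2 : List B), a ≠ b →
    S ≤ t.length → S ≤ t'.length →
    (b :: t).flatMap g ++ v1 = (a :: t').flatMap g ++ v2 →
    ∃ (Y : Type u) (_ : Fintype Y) (f : A → List Y) (h : Y → List B),
      Fintype.card Y < Fintype.card A ∧ NE f ∧ NE h ∧ ∀ x, g x = (f x).flatMap h := by
  classical
  intro S
  induction S with
  | zero =>
    intro g hg hS a b
    exfalso
    have h1 := hg.pos a
    have h2 := Finset.single_le_sum (f := fun x => (g x).length) (fun _ _ => Nat.zero_le _)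
      (Finset.mem_univ a)
    omega
  | succ S ih =>
    intro g hg hS
    have key : ∀ (a b : A) (t t' : List A) (v1 v2 : List B) (y : List B), a ≠ b →
        S + 1 ≤ t.length → S + 1 ≤ t'.length →
        (b :: t).flatMap g ++ v1 = (a :: t').flatMap g ++ v2 → g b = g a ++ y →
        ∃ (Y : Type u) (_ : Fintype Y) (f : A → List Y) (h : Y → List B),
          Fintype.card Y < Fintype.card A ∧ NE f ∧ NE h ∧ ∀ x, g x = (f x).flatMap h := by
      intro a b t t' v1 v2 y hab ht ht' heq hy
      by_cases hy0 : y = []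
      · subst hy0
        refine ⟨{x // x ≠ b}, inferInstance,
          fun x => if h : x = b then [⟨a, hab⟩] else [⟨x, h⟩], fun x => g x.1, ?_, ?_, ?_, ?_⟩
        · exact Fintype.card_subtype_lt (x := b) (by simp)
        · intro x; dsimp only; split_ifs <;> simp
        · intro x; exact hg x.1
        · intro x
          by_cases h : x = b
          · subst h; simp [hy]
          · simp [h]
      · let f : A → List A := fun x => if x = b then [a, b] else [x]
        let h : A → List B := Function.update g b y
        have hf : NE f := by intro x; dsimp only [f]; split_ifs <;> simp
        have hh : NE h := by
          intro x
          by_cases hx : x = b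
          · subst hx; simpa [h] using hy0
          · simpa [h, hx] using hg x
        have hgf : ∀ x, g x = (f x).flatMap h := by
          intro x
          by_cases hx : x = b
          · subst hx; simp [f, h, hy, hab]
          · simp [f, h, hx]
        have hsum : (∑ x, (h x).length) < ∑ x, (g x).length := by
          apply Finset.sum_lt_sum
          · intro x _
            by_cases hx : x = b
            · subst hx; simp [h, hy]
            · simp [h, hx]
          · refine ⟨b, Finset.mem_univ _, ?_⟩
            have := hg.pos a
            simp only [h, hy, Function.update_self, List.length_append]
            omega
        have hfl : ∀ w : List A, (w.flatMap f).flatMap h = w.flatMap g := by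
          intro w
          rw [List.flatMap_assoc]
          congr 1
          funext x
          exact (hgf x).symm
        have hlt := hf.length_le t
        have hlt' := hf.length_le t'
        obtain ⟨c, t'', hc⟩ : ∃ c t'', t'.flatMap f = c :: t'' := by
          cases hq : t'.flatMap f with
          | nil => rw [hq] at hlt'; simp at hlt'; simp [hlt'] at ht'
          | cons c t'' => exact ⟨c, t'', rfl⟩
        have hcb : c ≠ b := by
          cases t' with
          | nil => simp at ht'
          | cons d r =>
            by_cases hd : d = b
            · simp [f, hd] at hc; rw [← hc.1]; exact hab
            · simp [f, hd] at hc; rw [← hc.1]; exact hd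
        obtain ⟨Y, hY, f', h', k1, k2, k3, k4⟩ := ih h hh (by omega) c b (t.flatMap f) t'' v1 v2 hcb
          (by omega) (by rw [hc] at hlt'; simp at hlt'; omega) (by
            rw [← hc, List.flatMap_cons, hfl, hfl]
            simp only [List.flatMap_cons, hy, List.append_assoc, List.append_cancel_left_eq] at heq
            simpa [h] using heq)
        refine ⟨Y, hY, fun x => (f x).flatMap f', h', k1, ?_, k3, ?_⟩
        · intro x
          have e1 := k2.length_le (f x)
          have e2 := hf.pos x
          intro h0
          dsimp only at h0
          rw [h0] at e1
          simp at e1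
          simp [e1] at e2
        · intro x
          rw [List.flatMap_assoc, hgf]
          congr 1
          funext y
          exact k4 y
    intro a b t t' v1 v2 hab ht ht' heq
    have heq' := heq
    simp only [List.flatMap_cons, List.append_assoc] at heq'
    rcases List.append_eq_append_iff.1 heq' with ⟨y, h1, _⟩ | ⟨y, h1, _⟩
    · exact key b a t' t v2 v1 y hab.symm ht' ht heq.symm h1
    · exact key a b t t' v1 v2 y hab ht ht' heq h1

structure Good (Φ : ℕ → ℕ) (p : ℕ) : Prop where
  pos : 0 < p
  ex : Expd Φ
  md : ∀ a b, a ≡ b [MOD p] → Φ a ≡ Φ b [MOD p] ∧ ∀ l, Φ (a + l) + Φ b = Φ (b + l) + Φ a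
  grow : ∀ i B, ∃ j, Φ^[j] i + B ≤ Φ^[j] (i + 1)

lemma Good.iter {Φ : ℕ → ℕ} {p : ℕ} (h : Good Φ p) (c : ℕ) : ∀ a b, a ≡ b [MOD p] →
    Φ^[c] a ≡ Φ^[c] b [MOD p] ∧ ∀ l, Φ^[c] (a + l) + Φ^[c] b = Φ^[c] (b + l) + Φ^[c] a := by
  induction c with
  | zero => intro a b hab; exact ⟨hab, fun l => by simp only [Function.iterate_zero, id]; omega⟩
  | succ c ih =>
    intro a b hab
    obtain ⟨h1, h2⟩ := ih a b hab
    simp only [Function.iterate_succ_apply']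
    obtain ⟨h3, h4⟩ := h.md _ _ h1
    refine ⟨h3, fun l => ?_⟩
    have e1 := h.ex.iterate c a l
    have e2 := h.ex.iterate c b l
    have e3 := h2 l
    have e4 := h4 (Φ^[c] (a + l) - Φ^[c] a)
    rw [show Φ^[c] a + (Φ^[c] (a + l) - Φ^[c] a) = Φ^[c] (a + l) by omega,
      show Φ^[c] b + (Φ^[c] (a + l) - Φ^[c] a) = Φ^[c] (b + l) by omega] at e4
    exact e4

lemma ge_of_modEq {p d e : ℕ} (h : d ≡ e [MOD p]) (hlt : d < e) : d + p ≤ e := by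
  rw [Nat.modEq_iff_dvd' hlt.le] at h
  have := Nat.le_of_dvd (by omega) h
  omega

lemma Good.stuck {Φ : ℕ → ℕ} {p : ℕ} (h : Good Φ p) {a b c : ℕ} (hab : a < b) (hc : 0 < c)
    (ha : Φ^[c] a ≡ a [MOD p]) (hb : Φ^[c] b ≡ b [MOD p]) : Φ^[c] a + p ≤ Φ^[c] b := by
  obtain ⟨d, rfl⟩ := Nat.exists_eq_add_of_le hab.le
  have hE := h.ex.iterate c
  have e0 := hE a d
  have hd : a + d ≡ a + (Φ^[c] (a + d) - Φ^[c] a) [MOD p] := by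
    refine hb.symm.trans ?_
    have : Φ^[c] (a + d) = Φ^[c] a + (Φ^[c] (a + d) - Φ^[c] a) := by omega
    rw [this, Nat.add_sub_cancel_left]
    exact Nat.ModEq.add_right _ ha
  have hd := Nat.ModEq.add_left_cancel' _ hd
  rcases Nat.lt_or_ge d (Φ^[c] (a + d) - Φ^[c] a) with hlt | hge
  · have := ge_of_modEq hd hlt
    omega
  · exfalso
    have hst : Φ^[c] (a + d) = Φ^[c] a + d := by omega
    have all : ∀ j, (Φ^[c])^[j] a ≡ a [MOD p] ∧ (Φ^[c])^[j] (a + d) = (Φ^[c])^[j] a + d := by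
      intro j
      induction j with
      | zero => exact ⟨rfl, rfl⟩
      | succ j ih =>
        obtain ⟨i1, i2⟩ := ih
        rw [Function.iterate_succ_apply', Function.iterate_succ_apply', i2]
        obtain ⟨k1, k2⟩ := h.iter c _ _ i1
        refine ⟨k1.trans ha, ?_⟩
        have := k2 d
        omega
    obtain ⟨j, hj⟩ := h.grow a (d + 1)
    have a1 := (all j).2
    rw [← Function.iterate_mul] at a1
    have hcj : j ≤ c * j := Nat.le_mul_of_pos_left _ hc
    obtain ⟨r, hr⟩ := Nat.exists_eq_add_of_le hcj
    rw [hr, Nat.add_comm, Function.iterate_add_apply, Function.iterate_add_apply] at a1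
    have hj2 : Φ^[j] a + (d + 1) ≤ Φ^[j] (a + d) := by
      have := (h.ex.iterate j).le (a := a + 1) (b := a + d) (c := 0) (by omega)
      omega
    have := (h.ex.iterate r).le hj2
    omega

lemma Good.double {Φ : ℕ → ℕ} {p : ℕ} (h : Good Φ p) {a b : ℕ} (hab : a + p ≤ b) :
    Φ a + 2 * p ≤ Φ b := by
  have hp := h.pos
  have h0 : Φ (a + p) ≤ Φ b := h.ex.le (c := 0) hab
  have h1 : Φ a + p ≤ Φ (a + p) := h.ex a p
  have h2 : Φ a + p ≡ Φ (a + p) [MOD p] :=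
    (show Φ a + p ≡ Φ a [MOD p] by simp [Nat.ModEq]).trans
      (h.md a (a + p) (by simp [Nat.ModEq])).1
  rcases Nat.lt_or_ge (Φ a + p) (Φ (a + p)) with hlt | hge
  · have := ge_of_modEq h2 hlt
    omega
  · exfalso
    have up : ∀ l, Φ (a + l + p) = Φ (a + l) + p := by
      intro l
      have := (h.md a (a + p) (by simp [Nat.ModEq])).2 l
      rw [show a + p + l = a + l + p by omega] at this
      omega
    have all : ∀ j, a ≤ Φ^[j] a ∧ Φ^[j] (a + p) = Φ^[j] a + p := by
      intro j
      induction j with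
      | zero => exact ⟨le_rfl, rfl⟩
      | succ j ih =>
        rw [Function.iterate_succ_apply', Function.iterate_succ_apply', ih.2]
        have := up (Φ^[j] a - a)
        rw [Nat.add_sub_cancel' ih.1] at this
        refine ⟨?_, this⟩
        have := h.ex 0 (Φ^[j] a)
        rw [Nat.zero_add] at this
        omega
    obtain ⟨j, hj⟩ := h.grow a (p + 1)
    have := (all j).2
    have := (h.ex.iterate j).le (a := a + 1) (b := a + p) (c := 0) (by omega)
    omega

/-- The bijective case. -/
lemma Good.bij {Φ : ℕ → ℕ} {p : ℕ} (h : Good Φ p)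
    (inj : ∀ a b, Φ a ≡ Φ b [MOD p] → a ≡ b [MOD p]) :
    (∃ c, 0 < c ∧ ∀ a, Φ^[c] a ≡ a [MOD p]) ∧
    ∀ i, Φ^[2 * p] i + 2 * p ≤ Φ^[2 * p] (i + 1) := by
  classical
  have hp := h.pos
  have : NeZero p := ⟨hp.ne'⟩
  let π : ZMod p → ZMod p := fun x => (Φ x.val : ZMod p)
  have hπ : ∀ a : ℕ, π (a : ZMod p) = (Φ a : ZMod p) := by
    intro a
    simp only [π]
    rw [ZMod.natCast_eq_natCast_iff]
    apply (h.md _ _ _).1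
    rw [ZMod.val_natCast]
    exact Nat.mod_modEq _ _
  have hπi : ∀ (c a : ℕ), π^[c] (a : ZMod p) = (Φ^[c] a : ZMod p) := by
    intro c
    induction c with
    | zero => simp
    | succ c ih => intro a; rw [Function.iterate_succ_apply', Function.iterate_succ_apply', ih, hπ]
  have hinj : Function.Injective π := by
    intro x y hxy
    have h1 := (ZMod.natCast_eq_natCast_iff _ _ _).1 hxy
    have h2 := (ZMod.natCast_eq_natCast_iff _ _ _).2 (inj _ _ h1)
    simpa using h2
  have hper : ∀ x, x ∈ Function.periodicPts π := fun x => hinj.mem_periodicPts x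
  have conv : ∀ c a : ℕ, Function.IsPeriodicPt π c (a : ZMod p) ↔ Φ^[c] a ≡ a [MOD p] := by
    intro c a
    rw [Function.IsPeriodicPt, Function.IsFixedPt, hπi, ZMod.natCast_eq_natCast_iff]
  have hle : ∀ x, Function.minimalPeriod π x ≤ p := fun x => by
    simpa [ZMod.card] using Function.minimalPeriod_le_card (f := π) (x := x)
  have hpos : ∀ x, 0 < Function.minimalPeriod π x := fun x =>
    Function.minimalPeriod_pos_of_mem_periodicPts (hper x)
  have hmp : ∀ x, Function.IsPeriodicPt π (Function.minimalPeriod π x) x :=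
    fun x => Function.isPeriodicPt_minimalPeriod π x
  constructor
  · refine ⟨p.factorial, Nat.factorial_pos _, fun a => (conv _ _).1 ?_⟩
    exact (hmp a).trans_dvd (Nat.dvd_factorial (hpos _) (hle _))
  intro i
  -- it suffices to reach distance `p` in fewer than `2p` steps
  suffices hs : ∃ N, N < 2 * p ∧ Φ^[N] i + p ≤ Φ^[N] (i + 1) by
    obtain ⟨N, hN, hd⟩ := hs
    obtain ⟨r, hr⟩ := Nat.exists_eq_add_of_lt hN
    rw [show 2 * p = r + (1 + N) by omega, Function.iterate_add_apply, Function.iterate_add_apply,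
      Function.iterate_add_apply, Function.iterate_add_apply]
    have := h.double hd
    rw [show r + (1 + N) = 2 * p by omega]
    exact (h.ex.iterate r).le this
  set c1 := Function.minimalPeriod π (i : ZMod p) with hc1
  have ha := (conv c1 i).1 (hmp _)
  by_cases hb : Φ^[c1] (i + 1) ≡ i + 1 [MOD p]
  · by_cases hp1 : c1 < 2 * p
    · exact ⟨c1, hp1, h.stuck (Nat.lt_succ_self i) (hpos _) ha hb⟩
    · have := hle i; omega
  · set c2 := Function.minimalPeriod π ((i + 1 : ℕ) : ZMod p) with hc2
    have hc2p : c2 ≠ p := by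
      intro hE
      apply hb
      rw [← conv]
      have hinjO := Function.iterate_injOn_Iio_minimalPeriod (f := π) (x := ((i + 1 : ℕ) : ZMod p))
      have hsurj : (i : ZMod p) ∈ (Finset.range p).image (fun j => π^[j] ((i + 1 : ℕ) : ZMod p)) := by
        have : (Finset.range p).image (fun j => π^[j] ((i + 1 : ℕ) : ZMod p)) = Finset.univ := by
          apply Finset.eq_univ_of_card
          rw [Finset.card_image_of_injOn, Finset.card_range, ZMod.card]
          intro x hx y hy hxy
          rw [← hc2, hE] at hinjO
          exact hinjO (by simpa using hx) (by simpa using hy) hxy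
        rw [this]; exact Finset.mem_univ _
      obtain ⟨j, -, hj⟩ := Finset.mem_image.1 hsurj
      apply Function.isPeriodicPt_of_mem_periodicPts_of_isPeriodicPt_iterate (hper _) (n := j)
      rw [hj]
      exact hmp _
    have hc2l := hle ((i + 1 : ℕ) : ZMod p)
    have hc1l := hle (i : ZMod p)
    refine ⟨c2 + c1, by omega, ?_⟩
    rw [Function.iterate_add_apply, Function.iterate_add_apply]
    have hA := h.ex.iterate c1 i 1
    have hB : Φ^[c1] i + 1 ≡ i + 1 [MOD p] := Nat.ModEq.add_right _ ha
    have hlt : Φ^[c1] i + 1 < Φ^[c1] (i + 1) := by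
      rcases Nat.lt_or_ge (Φ^[c1] i + 1) (Φ^[c1] (i + 1)) with hlt | hge
      · exact hlt
      · exact absurd ((show Φ^[c1] (i + 1) = Φ^[c1] i + 1 by omega) ▸ hB) hb
    have hb2 := (conv c2 (i + 1)).1 (hmp _)
    have s1 : Φ^[c2] (Φ^[c1] i + 1) ≡ Φ^[c1] i + 1 [MOD p] :=
      ((h.iter c2 _ _ hB).1.trans hb2).trans hB.symm
    have s2 : Φ^[c2] (Φ^[c1] (i + 1)) ≡ Φ^[c1] (i + 1) [MOD p] := by
      rw [← Function.iterate_add_apply, Nat.add_comm, Function.iterate_add_apply]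
      exact (h.iter c1 _ _ hb2).1
    have := h.stuck (c := c2) hlt (hpos _) s1 s2
    have := h.ex.iterate c2 (Φ^[c1] i) 1
    omega

lemma exists_img {A : Type u} {B : Type v} (f : A → List B) (hf : NE f) (s : ℕ → A) :
    ∃ (Ψ : ℕ → ℕ) (t : ℕ → B), Ψ 0 = 0 ∧ Img f s Ψ t := by
  have hlen : ∀ k, k < ((fac s 0 (k + 1)).flatMap f).length := by
    intro k
    have := hf.length_le (fac s 0 (k + 1))
    simp only [fac_length] at this
    omega
  let t : ℕ → B := fun k => ((fac s 0 (k + 1)).flatMap f)[k]'(hlen k)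
  have pre : ∀ i l k, k < ((fac s 0 i).flatMap f).length →
      ((fac s 0 (i + l)).flatMap f)[k]? = ((fac s 0 i).flatMap f)[k]? := by
    intro i l k hk
    rw [fac_add, List.flatMap_append, List.getElem?_append_left hk]
  have key : ∀ i k, k < ((fac s 0 i).flatMap f).length →
      ((fac s 0 i).flatMap f)[k]? = some (t k) := by
    intro i k hk
    have ht : some (t k) = ((fac s 0 (k + 1)).flatMap f)[k]? := by
      rw [List.getElem?_eq_getElem (hlen k)]
    rw [ht]
    rcases le_total i (k + 1) with h | h
    · obtain ⟨l, hl⟩ := Nat.exists_eq_add_of_le h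
      rw [hl, pre i l k hk]
    · obtain ⟨l, hl⟩ := Nat.exists_eq_add_of_le h
      rw [hl, pre (k + 1) l k (hlen k)]
  refine ⟨fun i => ((fac s 0 i).flatMap f).length, t, by simp [fac_zero], fun i => ?_⟩
  have hs : (fac s 0 (i + 1)).flatMap f = (fac s 0 i).flatMap f ++ f (s i) := by
    rw [fac_add, fac_one]; simp
  refine ⟨by dsimp only; rw [hs, List.length_append], ?_⟩
  apply List.ext_getElem?
  intro k
  by_cases hk : k < (f (s i)).length
  · have h1 := key (i + 1) (((fac s 0 i).flatMap f).length + k) (by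
      rw [hs, List.length_append]; omega)
    rw [hs, List.getElem?_append_right (by omega), Nat.add_sub_cancel_left] at h1
    rw [h1]
    simp [fac, hk]
  · rw [List.getElem?_eq_none (by omega), List.getElem?_eq_none (by simp; omega)]

lemma Img.factor {A : Type u} {B : Type v} {C : Type w} {f : A → List B} {h : B → List C}
    {s : ℕ → A} {t : ℕ → B} {r : ℕ → C} {Φ Ψ : ℕ → ℕ} (hf : NE f)
    (hi : Img f s Ψ t) (h0 : Ψ 0 = 0) (hg : Img (fun x => (f x).flatMap h) s Φ r) :
    ∃ Θ, Img h t Θ r ∧ ∀ i, Θ (Ψ i) = Φ i := by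
  have e1 : ∀ i, (PLB.fac t 0 (Ψ i)).flatMap h =
      (PLB.fac s 0 i).flatMap (fun x => (f x).flatMap h) := by
    intro i
    obtain ⟨a1, a2⟩ := hi.fac 0 i
    rw [h0] at a1 a2
    rw [Nat.zero_add, Nat.zero_add] at a1
    rw [← a1] at a2
    rw [← a2, List.flatMap_assoc]
  refine ⟨fun k => Φ 0 + ((PLB.fac t 0 k).flatMap h).length, fun k => ?_, fun i => ?_⟩
  · have hs : (PLB.fac t 0 (k + 1)).flatMap h = (PLB.fac t 0 k).flatMap h ++ h (t k) := by
      rw [fac_add, fac_one]; simp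
    refine ⟨by dsimp only; rw [hs, List.length_append]; omega, ?_⟩
    have h1 := (hg.fac 0 (k + 1)).2
    have h2 := hi.expd hf 0 (k + 1)
    rw [h0, Nat.zero_add] at h2
    try rw [Nat.zero_add] at h2
    obtain ⟨l, hl⟩ := Nat.exists_eq_add_of_le h2
    rw [← e1, hl, fac_add, List.flatMap_append, hs, List.length_append, List.length_append,
      fac_add, fac_add] at h1
    have h3 := (List.append_inj h1 (by simp)).1
    exact (List.append_inj h3 (by simp)).2
  · have := (hg.fac 0 i).1
    rw [Nat.zero_add, ← e1] at this
    exact this.symm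

lemma img_iter {A : Type u} {g : A → List A} {s : ℕ → A} {Φ : ℕ → ℕ} (h : Img g s Φ s) (j : ℕ) :
    Img (fun x => iterM g j [x]) s Φ^[j] s := by
  induction j with
  | zero => intro i; simp [iterM, fac_one]
  | succ j ih =>
    have := ih.comp h
    have e : Φ^[j + 1] = fun i => Φ (Φ^[j] i) := funext fun i => Function.iterate_succ_apply' _ _ _
    rw [e]
    simpa only [iterM, Function.iterate_succ_apply', applyM] using! this

lemma Img.good {A : Type u} {g : A → List A} {s : ℕ → A} {Φ : ℕ → ℕ} {p : ℕ} (h : Img g s Φ s)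
    (hg : NE g) (hp : Per s p) (hgr : ∀ i B, ∃ j, Φ^[j] i + B ≤ Φ^[j] (i + 1)) : Good Φ p where
  pos := hp.1
  ex := h.expd hg
  md := by
    intro a b hab
    obtain ⟨h1, h2⟩ := h.shift hg ((hp.2 a b).2 hab)
    exact ⟨(hp.2 _ _).1 h2, h1⟩
  grow := hgr

lemma Per.eq_of_modEq {A : Type u} {s : ℕ → A} {p : ℕ} (hp : Per s p) {a b : ℕ}
    (h : a ≡ b [MOD p]) : s a = s b := (hp.2 a b).2 h 0

lemma comm_iter (Ψ Θ : ℕ → ℕ) (j k : ℕ) :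
    Ψ ((fun i => Θ (Ψ i))^[j] k) = (fun i => Ψ (Θ i))^[j] (Ψ k) := by
  induction j with
  | zero => rfl
  | succ j ih => rw [Function.iterate_succ_apply', Function.iterate_succ_apply', ih]

theorem main : ∀ (n : ℕ) (A : Type u) [Fintype A], Fintype.card A = n →
    ∀ (g : A → List A) (s : ℕ → A) (Φ : ℕ → ℕ) (p : ℕ), NE g → Img g s Φ s → Per s p →
    (∀ i B, ∃ j, Φ^[j] i + B ≤ Φ^[j] (i + 1)) →
    ∀ i, Φ^[2 * n] i + 2 * p ≤ Φ^[2 * n] (i + 1) := by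
  classical
  intro n
  induction n using Nat.strong_induction_on with
  | _ n ih =>
  intro A _ hA g s Φ p hg hI hp hgr i
  have G := hI.good hg hp hgr
  by_cases inj : ∀ a b, Φ a ≡ Φ b [MOD p] → a ≡ b [MOD p]
  · obtain ⟨⟨c, hc, hcp⟩, hb⟩ := G.bij inj
    have hsi : ∀ a b, s a = s b → a ≡ b [MOD p] := by
      intro a b hab
      obtain ⟨j, hj⟩ := hgr a p
      have hj2 : Φ^[c * j] a + p ≤ Φ^[c * j] (a + 1) := by
        obtain ⟨r, hr⟩ := Nat.exists_eq_add_of_le (Nat.le_mul_of_pos_left j hc)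
        rw [hr, Nat.add_comm j r, Function.iterate_add_apply, Function.iterate_add_apply]
        exact (G.ex.iterate r).le hj
      have hcj : ∀ a, Φ^[c * j] a ≡ a [MOD p] := by
        intro a
        rw [Function.iterate_mul]
        clear hj hj2
        induction j with
        | zero => rfl
        | succ j ihj => rw [Function.iterate_succ_apply']; exact (hcp _).trans ihj
      obtain ⟨x1, x2⟩ := img_iter hI (c * j) a
      obtain ⟨y1, y2⟩ := img_iter hI (c * j) b
      rw [← hab] at y1 y2
      simp only at x1 x2 y1 y2
      rw [x2] at y2
      simp only [fac_length] at y2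
      rw [fac_eq_iff] at y2
      have small : ∀ k < p, s (a + k) = s (b + k) := by
        intro k hk
        have e1 := y2 k (by omega)
        rwa [(hp.2 _ _).2 (hcj a) k, (hp.2 _ _).2 (hcj b) k] at e1
      rw [← hp.2]
      intro k
      have e1 := small (k % p) (Nat.mod_lt _ hp.1)
      rwa [hp.eq_of_modEq (Nat.ModEq.add_left a (Nat.mod_modEq k p)),
        hp.eq_of_modEq (Nat.ModEq.add_left b (Nat.mod_modEq k p))] at e1
    have hpn : p ≤ n := by
      rw [← hA, ← Fintype.card_fin p]
      apply Fintype.card_le_of_injective (fun k : Fin p => s k)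
      intro a b hab
      have := hsi _ _ hab
      exact Fin.ext (Nat.ModEq.eq_of_lt_of_lt this a.2 b.2)
    obtain ⟨r, hr⟩ := Nat.exists_eq_add_of_le (Nat.mul_le_mul_left 2 hpn)
    rw [hr, Nat.add_comm (2 * p) r, Function.iterate_add_apply, Function.iterate_add_apply]
    exact (G.ex.iterate r).le (hb i)
  · push Not at inj
    obtain ⟨a, b, h1, h2⟩ := inj
    -- move to the first mismatch
    obtain ⟨a, b, h1, h2⟩ : ∃ a b, Φ a ≡ Φ b [MOD p] ∧ s a ≠ s b := by
      rw [← hp.2] at h2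
      push Not at h2
      have hk := Nat.find_spec h2
      have hmin : ∀ j, j < Nat.find h2 → s (a + j) = s (b + j) := fun j hj =>
        not_not.1 (Nat.find_min h2 hj)
      generalize Nat.find h2 = k at *
      refine ⟨a + k, b + k, ?_, hk⟩
      have e := (fac_eq_iff s s a b k).2 hmin
      rw [(hI.fac a k).1, (hI.fac b k).1, e]
      exact Nat.ModEq.add_right _ h1
    have hcons : ∀ a l, fac s a (l + 1) = s a :: fac s (a + 1) l := by
      intro a l
      rw [Nat.add_comm l 1, fac_add, fac_one]; rfl
    set S := ∑ x, (g x).length with hS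
    have ea := (hI.fac a (S + 1)).2
    have eb := (hI.fac b (S + 1)).2
    rw [hcons] at ea eb
    have sh : ∀ l, fac s (Φ a) l = fac s (Φ b) l := fun l =>
      (fac_eq_iff _ _ _ _ _).2 fun k _ => (hp.2 _ _).2 h1 k
    set m1 := ((s a :: fac s (a + 1) S).flatMap g).length
    set m2 := ((s b :: fac s (b + 1) S).flatMap g).length
    obtain ⟨Y, hY, f, h, hcard, hf, hh, hgf⟩ := defect S g hg le_rfl (s a) (s b)
      (fac s (b + 1) S) (fac s (a + 1) S) (fac s (Φ b + m2) m1) (fac s (Φ a + m1) m2) h2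
      (by simp) (by simp) (by
        rw [ea, eb, ← fac_add, ← fac_add, sh, Nat.add_comm])
    obtain rfl : g = fun x => (f x).flatMap h := funext hgf
    obtain ⟨Ψ, t, h0, hft⟩ := exists_img f hf s
    obtain ⟨Θ, hht, hΘ⟩ := hft.factor hf h0 hI
    obtain rfl : Φ = fun i => Θ (Ψ i) := funext fun i => (hΘ i).symm
    have EΨ := hft.expd hf
    have EΘ := hht.expd hh
    have hcomp := hht.comp hft
    -- `t` is periodic
    have hex : ∃ p', Per t p' := by
      have hsp := (hp.2 0 p).2 (by simp [Nat.ModEq])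
      have h3 := (hft.shift hf hsp).2
      rw [h0] at h3
      have h4 := EΨ 0 p
      rw [Nat.zero_add] at h4
      obtain ⟨p', hp', -⟩ := exists_per t (Ψ p) (by have := hp.1; omega) (fun k => by
        have := h3 k
        rw [Nat.zero_add] at this
        rw [this, Nat.add_comm])
      exact ⟨p', hp'⟩
    obtain ⟨p', hp'⟩ := hex
    have hNE : NE (fun x => (h x).flatMap f) := by
      intro x h0
      have e1 := hf.length_le (h x)
      have e2 := hh.pos x
      dsimp only at h0
      rw [h0] at e1
      simp at e1
      simp [e1] at e2
    have hgr' : ∀ k B, ∃ j, (fun i => Ψ (Θ i))^[j] k + B ≤ (fun i => Ψ (Θ i))^[j] (k + 1) := by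
      intro k B
      obtain ⟨j, hj⟩ := hgr (Θ k) B
      refine ⟨j + 1, ?_⟩
      rw [Function.iterate_succ_apply, Function.iterate_succ_apply, ← comm_iter Ψ Θ, ← comm_iter Ψ Θ]
      apply EΨ.le
      refine hj.trans ?_
      exact (G.ex.iterate j).le (c := 0) (EΘ k 1)
    have IH := ih (Fintype.card Y) (hA ▸ hcard) Y rfl _ t _ p' hNE hcomp hp' hgr'
    have hΘp : ∀ k, Θ k + p ≤ Θ (k + p') := by
      intro k
      have e1 := (hp'.2 k (k + p')).2 (by simp [Nat.ModEq])
      have e2 := (hp.2 _ _).1 (hht.shift hh e1).2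
      apply ge_of_modEq e2
      have := EΘ k p'
      have := hp'.1
      omega
    have hstep : (fun i => Θ (Ψ i))^[2 * Fintype.card Y + 1] i + 2 * p ≤
        (fun i => Θ (Ψ i))^[2 * Fintype.card Y + 1] (i + 1) := by
      rw [Function.iterate_succ_apply', Function.iterate_succ_apply']
      rw [comm_iter Ψ Θ, comm_iter Ψ Θ]
      have e1 := IH (Ψ i)
      set q := (fun i => Ψ (Θ i))^[2 * Fintype.card Y]
      have e2 : q (Ψ i + 1) ≤ q (Ψ (i + 1)) :=
        ((hcomp.expd hNE).iterate _).le (c := 0) (EΨ i 1)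
      have e3 : q (Ψ i) + p' + p' ≤ q (Ψ (i + 1)) := by omega
      have e4 := EΘ.le (a := q (Ψ i) + p' + p') (c := 0) e3
      have e5 := hΘp (q (Ψ i))
      have e6 := hΘp (q (Ψ i) + p')
      omega
    obtain ⟨r, hr⟩ := Nat.exists_eq_add_of_le (show 2 * Fintype.card Y + 1 ≤ 2 * n by omega)
    rw [hr, Nat.add_comm _ r, Function.iterate_add_apply _ r, Function.iterate_add_apply _ r]
    exact (G.ex.iterate r).le hstep

lemma iterM_add {A : Type u} (g : A → List A) (a b : ℕ) (w : List A) :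
    iterM g (a + b) w = iterM g a (iterM g b w) := Function.iterate_add_apply _ _ _ _

lemma iterM_append {A : Type u} (g : A → List A) (k : ℕ) (v w : List A) :
    iterM g k (v ++ w) = iterM g k v ++ iterM g k w := by
  induction k with
  | zero => rfl
  | succ k ih =>
    rw [Nat.add_comm, iterM_add, iterM_add, iterM_add, ih]
    simp [iterM, applyM]

lemma iterM_nil {A : Type u} (g : A → List A) (k : ℕ) : iterM g k [] = [] := by
  have h := congrArg List.length (iterM_append g k [] [])
  simp only [List.append_nil, List.length_append] at h
  exact List.length_eq_zero_iff.1 (by omega)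

lemma iterM_pow {A : Type u} (g : A → List A) (k i : ℕ) (w : List A) :
    iterM (powM g k) i w = iterM g (k * i) w := by
  have h1 : ∀ w, applyM (powM g k) w = iterM g k w := by
    intro w
    induction w with
    | nil => rw [iterM_nil]; rfl
    | cons a w ih =>
      rw [← List.singleton_append, iterM_append, ← ih]
      simp [applyM, powM]
  induction i with
  | zero => rfl
  | succ i ih =>
    rw [Nat.mul_succ, Nat.add_comm, iterM_add, Nat.add_comm (k * i), iterM_add, ih, ← h1]
    rfl

lemma iterM_length {A : Type u} {g : A → List A} (hg : NE g) (k : ℕ) (w : List A) :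
    w.length ≤ (iterM g k w).length := by
  induction k with
  | zero => exact le_rfl
  | succ k ih =>
    rw [Nat.add_comm, iterM_add]
    exact ih.trans (hg.length_le _)

lemma fac_mul {A : Type u} (s : ℕ → A) (p : ℕ) (hs : ∀ a, fac s (a + p) p = fac s a p) (j : ℕ) :
    fac s 0 (p * j) = (List.replicate j (fac s 0 p)).flatten := by
  have h0 : ∀ j, fac s (p * j) p = fac s 0 p := by
    intro j
    induction j with
    | zero => rfl
    | succ j ih => rw [Nat.mul_succ, hs, ih]
  induction j with
  | zero => simp [fac_zero]
  | succ j ih =>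
    rw [Nat.mul_succ, fac_add, ih, List.replicate_succ', Nat.zero_add, h0]
    simp

lemma per_of_primitive {A : Type u} (s : ℕ → A) (U : List A) (hu : PrimitiveWord U)
    (hper : IsPeriodicWord s U) : Per s U.length := by
  have hpos : 0 < U.length := List.length_pos_iff.2 hu.1
  have hs : ∀ i, s (i + U.length) = s i := by
    intro i
    rw [hper.2 _ (Nat.mod_lt _ hpos), hper.2 _ (Nat.mod_lt _ hpos)]
    simp
  obtain ⟨p, hp, j, hj⟩ := exists_per s _ hpos hs
  have hU : U = fac s 0 U.length := by
    apply List.ext_getElem (by simp)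
    intro i h1 h2
    simp only [fac, List.getElem_map, List.getElem_range, Nat.zero_add]
    rw [hper.2 _ (Nat.mod_lt _ hpos)]
    simp [Nat.mod_eq_of_lt h1]
  rcases Nat.lt_or_ge j 2 with h | h
  · have : j = 1 := by
      have : j ≠ 0 := by rintro rfl; omega
      omega
    rw [hj, this, Nat.mul_one]; exact hp
  · exfalso
    apply hu.2
    refine ⟨fac s 0 p, j, h, ?_, ?_⟩
    · rw [fac_length, hj]
      have := hp.1
      nlinarith
    · rw [← fac_mul, ← hj]; exact hU
      intro a
      rw [fac_eq_iff]
      intro k _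
      exact (hp.2 _ _).2 (by simp [Nat.ModEq]) k

end PLB

open PLB
/-- If `g` is primitive on an alphabet with `n` letters and
`(g^k)^ω(x) = u^ω` for a primitive word `u`, then `|g^{2n}(z)| ≥ 2|u|` for all letters `z`. -/
theorem primitive_looping_length_bound {X : Type*} [Fintype X]
    (n : ℕ) (hn : n = Fintype.card X)
    (g : X → List X) (hg : Primitive g)
    (x : X) (k : ℕ) (hk : 0 < k) (u : List X) (hu : PrimitiveWord u)
    (s : ℕ → X) (hs : IsOmega (powM g k) x s) (hper : IsPeriodicWord s u) :
    ∀ z : X, 2 * u.length ≤ (iterM g (2 * n) [z]).length := by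
  classical
  obtain ⟨K, hK, hall⟩ := hg
  have hNE : NE g := by
    intro y hy
    have h1 := hall x y
    obtain ⟨K', rfl⟩ : ∃ K', K = K' + 1 := ⟨K - 1, by omega⟩
    rw [iterM_add] at h1
    have h2 : iterM g 1 [y] = [] := by simp [iterM, applyM, hy]
    rw [h2, iterM_nil] at h1
    simp at h1
  have hP := per_of_primitive s u hu hper
  have pref : ∀ i, iterM g (k * i) [x] = fac s 0 (iterM g (k * i) [x]).length := by
    intro i
    have h1 := hs.2 i
    rw [iterM_pow] at h1
    apply List.ext_getElem (by simp)
    intro j h2 h3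
    simp only [fac, List.getElem_map, List.getElem_range, Nat.zero_add]
    exact h1 j h2
  have long : ∀ B, ∃ i, B ≤ (iterM g (k * i) [x]).length := by
    intro B
    obtain ⟨i, hi⟩ := (hs.1.2.eventually_ge_atTop B).exists
    rw [iterM_pow] at hi
    exact ⟨i, hi⟩
  have big : ∀ M, K ≤ M → ∀ a b, a ∈ iterM g M [b] := by
    intro M hM a b
    obtain ⟨d, rfl⟩ := Nat.exists_eq_add_of_le hM
    rw [iterM_add]
    have h1 := iterM_length hNE d [b]
    cases hd : iterM g d [b] with
    | nil => rw [hd] at h1; simp at h1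
    | cons c r =>
      rw [← List.singleton_append, iterM_append]
      exact List.mem_append_left _ (hall a c)
  obtain ⟨Ψ, t, h0, hΨ⟩ := exists_img g hNE s
  have loc : ∀ N, ∃ q, ∀ j < N, t j = s (q + j) := by
    intro N
    obtain ⟨i, hi⟩ := long N
    have e1 := (hΨ.fac 0 (iterM g (k * i) [x]).length).2
    rw [← pref, h0] at e1
    have e2 := hNE.length_le (iterM g (k * i) [x])
    have hle : K + 1 ≤ k * (K + 1) := Nat.le_mul_of_pos_left _ hk
    have hx := big (k * (K + 1) - 1) (by omega) x x
    obtain ⟨al, be, hab⟩ := List.append_of_mem hx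
    have e3 := pref (i + (K + 1))
    have e4 : iterM g (k * (i + (K + 1))) [x] = iterM g (1 + k * i) al ++
        ((iterM g (k * i) [x]).flatMap g ++ iterM g (1 + k * i) be) := by
      rw [show k * (i + (K + 1)) = (1 + k * i) + (k * (K + 1) - 1) by rw [Nat.mul_add]; omega,
        iterM_add, hab, iterM_append, ← List.singleton_append (l := be), iterM_append,
        iterM_add g 1 (k * i) [x]]
      rfl
    rw [e4, List.length_append, List.length_append, fac_add, fac_add] at e3
    have e5 := (List.append_inj e3 (by simp)).2
    have e6 := (List.append_inj e5 (by simp)).1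
    rw [e6] at e1
    simp only [fac_length] at e1
    rw [fac_eq_iff] at e1
    refine ⟨0 + (iterM g (1 + k * i) al).length, fun j hj => ?_⟩
    have := e1 j (by omega)
    rw [this, Nat.zero_add]
  have glob : ∃ q, ∀ j, t j = s (q + j) := by
    by_contra hc
    push Not at hc
    choose κ hκ using hc
    obtain ⟨q, hq⟩ := loc ((Finset.range u.length).sup κ + 1)
    apply hκ (q % u.length)
    have hm : q % u.length ∈ Finset.range u.length := Finset.mem_range.2 (Nat.mod_lt _ hP.1)
    rw [hq _ (Nat.lt_succ_of_le (Finset.le_sup (f := κ) hm))]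
    exact (hP.2 _ _).2 (Nat.mod_modEq _ _).symm _
  obtain ⟨q, hq⟩ := glob
  have hI : Img g s (fun i => q + Ψ i) s := by
    intro i
    obtain ⟨h1, h2⟩ := hΨ i
    refine ⟨by dsimp only; omega, ?_⟩
    refine h2.trans ((fac_eq_iff _ _ _ _ _).2 fun j _ => ?_)
    rw [hq]
    dsimp only
    rw [Nat.add_assoc]
  have hgr : ∀ i B, ∃ j, (fun i => q + Ψ i)^[j] i + B ≤ (fun i => q + Ψ i)^[j] (i + 1) := by
    intro i B
    obtain ⟨i0, hi0⟩ := long B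
    refine ⟨k * i0 + K, ?_⟩
    have h1 := (img_iter hI (k * i0 + K) i).1
    obtain ⟨al, be, hab⟩ := List.append_of_mem (hall x (s i))
    simp only [iterM_add, hab] at h1
    rw [h1, ← List.singleton_append (l := be), iterM_append, iterM_append, List.length_append,
      List.length_append]
    omega
  intro z
  have hz := big (k * K) (Nat.le_mul_of_pos_left _ hk) z x
  rw [pref] at hz
  obtain ⟨i, -, rfl⟩ := List.mem_map.1 hz
  have h1 := (img_iter hI (2 * n) (0 + i)).1
  have h2 := PLB.main n X hn.symm g s _ u.length hNE hI hP hgr (0 + i)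
  simp only at h1
  omega
end

section
/- Let X be an alphabet having n ≥ 2 letters and let g, h: X* → X* be morphisms. Define M = max{M_g, M_h}. If BAL(g, h) < ∞, then BAL(g, h) ≤ M^{2n−1}·exp(n²(1 + √(6n log n))). -/
open Filter Set

variable {X : Type*}

open Polynomial in
/-- Coefficients of `X^k mod q` are bounded by `m!` if `q` of degree `m` divides `X^P - 1`. -/
lemma coeff_bound_aux (q : ℚ[X]) (hq : q.Monic) (P : ℕ) (hP : 0 < P) (hdvd : q ∣ Polynomial.X ^ P - 1)
    (k j : ℕ) (hj : j < q.natDegree) :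
    |(((Polynomial.X ^ k %ₘ q).coeff j : ℚ) : ℝ)| ≤ (q.natDegree.factorial : ℝ) := by
  classical
  have hsepP : (Polynomial.X ^ P - 1 : ℚ[X]).Separable :=
    separable_X_pow_sub_C (1 : ℚ) (by exact_mod_cast hP.ne') one_ne_zero
  have hsep : q.Separable := hsepP.of_dvd hdvd
  let K := q.SplittingField
  have hspl : (q.map (algebraMap ℚ K)).Splits := SplittingField.splits q
  have : IsGalois ℚ K := by
    have h := @IsGalois.of_separable_splitting_field ℚ _ q.SplittingField _ _ q
      (Polynomial.IsSplittingField.splittingField q) hsep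
    convert h
  have : NumberField K := { to_charZero := inferInstance, to_finiteDimensional := inferInstance }
  have hcard : Fintype.card (q.rootSet K) = q.natDegree :=
    card_rootSet_eq_natDegree hsep hspl
  generalize hm : q.natDegree = m at *
  let e : Fin m ≃ q.rootSet K := (Fintype.equivFinOfCardEq hcard).symm
  let α : Fin m → K := fun i => (e i : K)
  have hαinj : Function.Injective α := Subtype.val_injective.comp e.injective
  have hαroot : ∀ i, aeval (α i) q = 0 := fun i => (mem_rootSet.mp (e i).2).2
  have hαpow : ∀ i, α i ^ P = 1 := by
    intro i
    obtain ⟨s, hs⟩ := hdvd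
    have := congrArg (aeval (α i)) hs
    simp [hαroot] at this
    exact sub_eq_zero.mp this
  let V := Matrix.vandermonde α
  have hdet0 : V.det ≠ 0 := Matrix.det_vandermonde_ne_zero_iff.mpr hαinj
  have hαint : ∀ i, IsIntegral ℤ (α i) := fun i =>
    IsIntegral.of_pow hP (by rw [hαpow]; exact isIntegral_one)
  have hdetint : IsIntegral ℤ (V.det ^ 2) := by
    apply IsIntegral.pow
    rw [Matrix.det_vandermonde]
    exact IsIntegral.prod _ fun i _ => IsIntegral.prod _ fun j _ => (hαint j).sub (hαint i)
  have hfix : ∀ σ : Gal(K/ℚ), σ (V.det ^ 2) = V.det ^ 2 := by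
    intro σ
    have hmem : ∀ i, σ (α i) ∈ q.rootSet K := by
      intro i
      rw [mem_rootSet]
      refine ⟨hq.ne_zero, ?_⟩
      have := congrArg σ (hαroot i)
      rwa [map_zero, ← AlgEquiv.coe_toAlgHom, ← aeval_algHom_apply] at this
    let f : Fin m → Fin m := fun i => e.symm ⟨σ (α i), hmem i⟩
    have hf : ∀ i, α (f i) = σ (α i) := by intro i; simp [f, α]
    have hfinj : Function.Injective f := by
      intro a b hab
      apply hαinj
      apply σ.injective
      rw [← hf, ← hf, hab]
    let π : Equiv.Perm (Fin m) := Equiv.ofBijective f (Finite.injective_iff_bijective.mp hfinj)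
    have h1 : σ V.det = (V.submatrix π id).det := by
      rw [AlgEquiv.map_det]
      congr 1
      ext a b
      simp [V, Matrix.vandermonde_apply, π, hf]
    rw [map_pow, h1, Matrix.det_permute, mul_pow]
    rcases Int.units_eq_one_or (Equiv.Perm.sign π) with h | h <;> simp [h]
  obtain ⟨y, hy⟩ := (IsGalois.mem_range_algebraMap_iff_fixed (F := ℚ) (V.det ^ 2)).mpr hfix
  have hyint : IsIntegral ℤ y := by
    rw [← hy] at hdetint
    exact (isIntegral_algebraMap_iff (algebraMap ℚ K).injective).mp hdetint
  obtain ⟨z, hz⟩ := IsIntegrallyClosed.isIntegral_iff.mp hyint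
  have hz0 : z ≠ 0 := by
    rintro rfl
    apply hdet0
    rw [← hz] at hy
    simpa using hy.symm
  let φ : K →+* ℂ := Classical.arbitrary (K →+* ℂ)
  let abv : AbsoluteValue K ℝ :=
    { toFun := fun x => ‖φ x‖
      map_mul' := fun x y => by simp
      nonneg' := fun x => norm_nonneg _
      eq_zero' := fun x => by simp
      add_le' := fun x y => by simpa using norm_add_le (φ x) (φ y) }
  have habvq : ∀ c : ℚ, abv (algebraMap ℚ K c) = |(c : ℝ)| := by
    intro c
    change ‖φ (algebraMap ℚ K c)‖ = _
    rw [eq_ratCast, map_ratCast]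
    simp
  have hdet1 : 1 ≤ abv V.det := by
    have h2 : abv V.det ^ 2 = |(z : ℝ)| := by
      rw [← map_pow, ← hy, habvq, ← hz]; simp
    have h3 : (1 : ℝ) ≤ |(z : ℝ)| := by exact_mod_cast Int.one_le_abs hz0
    nlinarith [abv.nonneg V.det]
  have habvα : ∀ i, abv (α i) = 1 := by
    intro i
    have h2 : abv (α i) ^ P = 1 := by rw [← map_pow, hαpow, map_one]
    exact (pow_eq_one_iff_of_nonneg (abv.nonneg _) hP.ne').mp h2
  let r := Polynomial.X ^ k %ₘ q
  have hrdeg : r.natDegree < m := by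
    rw [← hm]
    apply natDegree_modByMonic_lt _ hq
    rintro rfl
    simp at hm
    omega
  let rv : Fin m → K := fun i => algebraMap ℚ K (r.coeff i)
  let b : Fin m → K := fun i => α i ^ k
  have hVr : V.mulVec rv = b := by
    ext i
    have h1 : aeval (α i) r = α i ^ k := by
      have := congrArg (aeval (α i)) (modByMonic_add_div (Polynomial.X ^ k) q)
      simpa [hαroot] using this
    simp only [b]
    rw [← h1, aeval_eq_sum_range' hrdeg, Matrix.mulVec, dotProduct, ← Fin.sum_univ_eq_sum_range
      (fun j => r.coeff j • α i ^ j)]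
    refine Finset.sum_congr rfl fun j _ => ?_
    simp [V, rv, Matrix.vandermonde_apply, Algebra.smul_def, mul_comm]
  have hcr : V.det • rv = V.cramer b := by
    rw [Matrix.cramer_eq_adjugate_mulVec, ← hVr, Matrix.mulVec_mulVec, Matrix.adjugate_mul,
      Matrix.smul_mulVec, Matrix.one_mulVec]
  have hcj := congrFun hcr ⟨j, hj⟩
  rw [Matrix.cramer_apply] at hcj
  have hbd := Matrix.det_le (A := V.updateCol ⟨j, hj⟩ b) (abv := abv) (x := 1) (by
    intro a c
    rw [Matrix.updateCol_apply]
    split_ifs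
    · simp [b, habvα]
    · simp [V, Matrix.vandermonde_apply, habvα])
  rw [← hcj] at hbd
  simp only [Pi.smul_apply, smul_eq_mul, map_mul, rv, habvq, Fintype.card_fin, one_pow,
    nsmul_eq_mul, mul_one] at hbd
  calc _ ≤ abv V.det * |((r.coeff j : ℚ) : ℝ)| := le_mul_of_one_le_left (abs_nonneg _) hdet1
    _ ≤ _ := hbd

open Polynomial in
lemma linear_bound_aux {ι : Type*} [Fintype ι] (T : Module.End ℚ (ι → ℚ)) (w : ι → ℚ)
    (i j : ℕ) (hij : i < j) (hw : (T ^ i) w = (T ^ j) w) (B : ℝ)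
    (hB : ∀ k < Fintype.card ι, ∀ x, |(((T ^ k) w x : ℚ) : ℝ)| ≤ B) (k : ℕ) (x : ι) :
    |(((T ^ k) w x : ℚ) : ℝ)| ≤
      (Fintype.card ι : ℝ) * ((Fintype.card ι).factorial : ℝ) * B := by
  classical
  have hn : 0 < Fintype.card ι := Fintype.card_pos_iff.mpr ⟨x⟩
  have hB0 : 0 ≤ B := (abs_nonneg _).trans (hB 0 hn x)
  have hfac : (1 : ℝ) ≤ (Fintype.card ι : ℝ) * ((Fintype.card ι).factorial : ℝ) := by
    have : 1 ≤ Fintype.card ι * (Fintype.card ι).factorial :=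
      Nat.mul_pos hn (Nat.factorial_pos _)
    exact_mod_cast this
  have hχ0 : T.charpoly ≠ 0 := T.charpoly_monic.ne_zero
  have hχdeg : T.charpoly.natDegree = Fintype.card ι := by
    rw [LinearMap.charpoly_natDegree, Module.finrank_fintype_fun_eq_card]
  obtain ⟨c, hc, hcX⟩ := exists_eq_pow_rootMultiplicity_mul_and_not_dvd T.charpoly hχ0 0
  generalize rootMultiplicity 0 T.charpoly = a at hc
  rw [C_0, sub_zero] at hc hcX
  have hc0 : c ≠ 0 := by rintro rfl; simp at hcX
  have hdeg : a + c.natDegree = Fintype.card ι := by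
    rw [← hχdeg, hc, natDegree_mul (pow_ne_zero _ X_ne_zero) hc0, natDegree_X_pow]
  by_cases hka : k < a
  · refine (hB k (by omega) x).trans ?_
    exact le_mul_of_one_le_left hB0 hfac
  let u := (T ^ a) w
  have hcu : aeval T c u = 0 := by
    have h1 := LinearMap.congr_fun (LinearMap.aeval_self_charpoly T) w
    rw [hc, mul_comm, map_mul, map_pow, aeval_X] at h1
    exact h1
  obtain ⟨P, rfl⟩ : ∃ P, j = i + P := ⟨j - i, by omega⟩
  have hP : 0 < P := by omega
  have hPu0 : aeval T (Polynomial.X ^ i * (Polynomial.X ^ P - 1) : ℚ[X]) u = 0 := by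
    have : aeval T (Polynomial.X ^ i * (Polynomial.X ^ P - 1) : ℚ[X]) u =
        aeval T (Polynomial.X ^ a * (Polynomial.X ^ (i + P) - Polynomial.X ^ i) : ℚ[X]) w := by
      have e : (Polynomial.X ^ a * (Polynomial.X ^ (i + P) - Polynomial.X ^ i) : ℚ[X]) = (Polynomial.X ^ i * (Polynomial.X ^ P - 1)) * Polynomial.X ^ a := by ring
      rw [e, map_mul _ _ (Polynomial.X ^ a), map_pow, aeval_X]
      rfl
    rw [this, map_mul, Module.End.mul_apply]
    simp [hw]
  have hcop : IsCoprime c (Polynomial.X ^ i) := by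
    apply IsCoprime.pow_right
    exact ((irreducible_X.coprime_iff_not_dvd).mpr hcX).symm
  have hPu : aeval T (Polynomial.X ^ P - 1 : ℚ[X]) u = 0 := by
    obtain ⟨s, t, hst⟩ := hcop
    have e : (Polynomial.X ^ P - 1 : ℚ[X]) = ((Polynomial.X ^ P - 1) * s) * c + t * (Polynomial.X ^ i * (Polynomial.X ^ P - 1)) := by
      linear_combination (-(Polynomial.X ^ P - 1 : ℚ[X])) * hst
    rw [e, map_add, map_mul _ _ c, map_mul _ t, LinearMap.add_apply, Module.End.mul_apply,
      Module.End.mul_apply, hcu, hPu0]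
    simp
  obtain ⟨q, hq, hqc, hqP, s, t, hst⟩ : ∃ q : ℚ[X], q.Monic ∧ q ∣ c ∧ q ∣ Polynomial.X ^ P - 1 ∧
      ∃ s t, s * c + t * (Polynomial.X ^ P - 1) = q := by
    have hd0 : EuclideanDomain.gcd c (Polynomial.X ^ P - 1) ≠ 0 := by
      intro h; exact hc0 (EuclideanDomain.gcd_eq_zero_iff.mp h).1
    set d := EuclideanDomain.gcd c (Polynomial.X ^ P - 1) with hd
    have hassoc : Associated d (d * C d.leadingCoeff⁻¹) := by
      refine associated_mul_unit_right _ _ ?_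
      exact isUnit_C.mpr (inv_ne_zero (leadingCoeff_ne_zero.mpr hd0)).isUnit
    refine ⟨d * C d.leadingCoeff⁻¹, monic_mul_leadingCoeff_inv hd0, ?_, ?_,
      EuclideanDomain.gcdA c (Polynomial.X ^ P - 1) * C d.leadingCoeff⁻¹,
      EuclideanDomain.gcdB c (Polynomial.X ^ P - 1) * C d.leadingCoeff⁻¹, ?_⟩
    · exact hassoc.symm.dvd.trans (EuclideanDomain.gcd_dvd_left _ _)
    · exact hassoc.symm.dvd.trans (EuclideanDomain.gcd_dvd_right _ _)
    · have := EuclideanDomain.gcd_eq_gcd_ab c (Polynomial.X ^ P - 1)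
      rw [← hd] at this
      linear_combination (-C d.leadingCoeff⁻¹) * this
  have hqu : aeval T q u = 0 := by
    rw [← hst, map_add, map_mul, map_mul, LinearMap.add_apply, Module.End.mul_apply,
      Module.End.mul_apply, hcu, hPu]
    simp
  have hqdeg : q.natDegree ≤ c.natDegree := natDegree_le_of_dvd hqc hc0
  obtain ⟨l, rfl⟩ : ∃ l, k = l + a := ⟨k - a, by omega⟩
  have hTl : (T ^ (l + a)) w = aeval T (Polynomial.X ^ l %ₘ q) u := by
    have h1 : aeval T (Polynomial.X ^ l : ℚ[X]) u = (T ^ (l + a)) w := by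
      rw [pow_add, map_pow, aeval_X]; rfl
    rw [← h1]
    conv_lhs => rw [← modByMonic_add_div (Polynomial.X ^ l) q]
    rw [map_add, mul_comm q, map_mul, LinearMap.add_apply, Module.End.mul_apply, hqu]
    simp
  by_cases hq1 : q = 1
  · rw [hTl, hq1]
    simp
    positivity
  have hrdeg := natDegree_modByMonic_lt (Polynomial.X ^ l) hq hq1
  have hexp : (T ^ (l + a)) w x =
      ∑ b ∈ Finset.range q.natDegree, (Polynomial.X ^ l %ₘ q).coeff b * (T ^ (b + a)) w x := by
    rw [hTl, aeval_eq_sum_range' hrdeg]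
    simp [LinearMap.sum_apply, pow_add, u]
  rw [hexp, Rat.cast_sum]
  refine (Finset.abs_sum_le_sum_abs _ _).trans ?_
  have hterm : ∀ b ∈ Finset.range q.natDegree,
      |(((Polynomial.X ^ l %ₘ q).coeff b * (T ^ (b + a)) w x : ℚ) : ℝ)| ≤
        ((Fintype.card ι).factorial : ℝ) * B := by
    intro b hb
    rw [Finset.mem_range] at hb
    rw [Rat.cast_mul, abs_mul]
    have h1 := coeff_bound_aux q hq P hP hqP l b hb
    have h2 := hB (b + a) (by omega) x
    have h3 : (q.natDegree.factorial : ℝ) ≤ ((Fintype.card ι).factorial : ℝ) := by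
      exact_mod_cast Nat.factorial_le (by omega)
    exact mul_le_mul (h1.trans h3) h2 (abs_nonneg _) (by positivity)
  refine (Finset.sum_le_card_nsmul _ _ _ hterm).trans ?_
  rw [Finset.card_range, nsmul_eq_mul, ← mul_assoc]
  have h4 : (q.natDegree : ℝ) ≤ (Fintype.card ι : ℝ) := by
    exact_mod_cast (by omega : q.natDegree ≤ Fintype.card ι)
  gcongr

/-- Pull back of weights along a morphism, as a linear endomorphism. -/
noncomputable def pullT {X : Type*} (g : X → List X) : Module.End ℚ (X → ℚ) where
  toFun w := fun x => ((g x).map w).sum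
  map_add' u v := by
    ext x
    exact List.sum_map_add
  map_smul' c u := by
    ext x
    exact List.sum_map_mul_left (g x) u c

lemma pullT_apply_sum {X : Type*} (g : X → List X) (w : X → ℚ) (l : List X) :
    (l.map (pullT g w)).sum = ((applyM g l).map w).sum := by
  induction l with
  | nil => simp [applyM]
  | cons a l ih =>
    simp only [applyM, List.flatMap_cons, List.map_append, List.sum_append, List.map_cons,
      List.sum_cons] at ih ⊢
    rw [ih]; rfl

lemma pullT_pow_sum {X : Type*} (g : X → List X) (w : X → ℚ) (k : ℕ) (l : List X) :
    (l.map ((pullT g ^ k) w)).sum = ((iterM g k l).map w).sum := by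
  induction k generalizing l with
  | zero => simp [iterM]
  | succ k ih =>
    rw [pow_succ', Module.End.mul_apply, pullT_apply_sum, ih]
    simp [iterM, Function.iterate_succ_apply]

lemma length_applyM_sum {X : Type*} (g : X → List X) (l : List X) :
    ((applyM g l).length : ℚ) = (l.map fun x => ((g x).length : ℚ)).sum := by
  induction l with
  | nil => simp [applyM]
  | cons a l ih =>
    simp only [applyM, List.flatMap_cons, List.length_append, Nat.cast_add, List.map_cons,
      List.sum_cons] at ih ⊢
    rw [ih]

lemma length_applyM_le {X : Type*} (g : X → List X) (M : ℕ) (hg : ∀ x, (g x).length ≤ M)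
    (l : List X) : (applyM g l).length ≤ M * l.length := by
  induction l with
  | nil => simp [applyM]
  | cons a l ih =>
    simp only [applyM, List.flatMap_cons, List.length_append, List.length_cons] at ih ⊢
    have := hg a
    nlinarith

lemma length_iterM_le {X : Type*} (g : X → List X) (M : ℕ) (hg : ∀ x, (g x).length ≤ M)
    (k : ℕ) (l : List X) : (iterM g k l).length ≤ M ^ k * l.length := by
  induction k with
  | zero => simp [iterM]
  | succ k ih =>
    have h1 : iterM g (k + 1) l = applyM g (iterM g k l) := by
      simp [iterM, Function.iterate_succ_apply']
    rw [h1]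
    refine (length_applyM_le g M hg _).trans ?_
    rw [pow_succ', mul_assoc]
    exact Nat.mul_le_mul_left _ ih

lemma factorial_succ_le_pow_aux (m : ℕ) : (m + 1).factorial ≤ (m + 1) ^ m := by
  induction m with
  | zero => simp
  | succ m ih =>
    rw [Nat.factorial_succ, pow_succ']
    exact Nat.mul_le_mul_left _ (ih.trans (Nat.pow_le_pow_left (by omega) _))

/-- If `X` has `n ≥ 2` letters and `BAL(g,h) < ∞`, then
`BAL(g,h) ≤ M^{2n-1} exp(n²(1 + √(6 n log n)))` where `M = max{M_g, M_h}`. -/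
theorem bal_upper_bound {X : Type*} [Fintype X]
    (n : ℕ) (hn : n = Fintype.card X) (hn2 : 2 ≤ n)
    (g h : X → List X) (M : ℕ) (hM : M = max (Mg g) (Mg h))
    (hbal : BAL g h < ⊤) :
    ((BAL g h).toNat : ℝ) ≤
      (M : ℝ) ^ (2 * n - 1) * Real.exp ((n : ℝ) ^ 2 * (1 + Real.sqrt (6 * n * Real.log n))) := by
  classical
  have hgM : ∀ x, (g x).length ≤ M := by
    intro x
    rw [hM]
    exact le_max_of_le_left (Finset.le_sup (f := fun x => (g x).length) (Finset.mem_univ x))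
  have hhM : ∀ x, (h x).length ≤ M := by
    intro x
    rw [hM]
    exact le_max_of_le_right (Finset.le_sup (f := fun x => (h x).length) (Finset.mem_univ x))
  let D : ℕ → X → ℤ := fun k x => ((applyM g (iterM g k [x])).length : ℤ) -
      ((applyM h (iterM g k [x])).length : ℤ)
  let w : X → ℚ := fun x => ((g x).length : ℚ) - ((h x).length : ℚ)
  have hD : ∀ k x, (pullT g ^ k) w x = (D k x : ℚ) := by
    intro k x
    have h1 := pullT_pow_sum g w k [x]
    simp only [List.map_cons, List.map_nil, List.sum_cons, List.sum_nil, add_zero] at h1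
    rw [h1]
    simp only [D]
    push_cast
    rw [length_applyM_sum, length_applyM_sum, eq_sub_iff_add_eq, ← List.sum_map_add]
    simp [w]
  have hle : ∀ k x, ((D k x).natAbs : ℕ∞) ≤ BAL g h := by
    intro k x
    exact le_iSup₂ (f := fun (x : X) (k : ℕ) => ((((applyM g (iterM g k [x])).length : ℤ) -
      ((applyM h (iterM g k [x])).length : ℤ)).natAbs : ℕ∞)) x k
  obtain ⟨N, hN⟩ := ENat.ne_top_iff_exists.mp hbal.ne
  have hDN : ∀ k x, (D k x).natAbs ≤ N := by
    intro k x
    have := hle k x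
    rw [← hN] at this
    exact_mod_cast this
  -- pigeonhole
  obtain ⟨i, j, hij, hDij⟩ : ∃ i j, i < j ∧ D i = D j := by
    have hfin : (Set.pi Set.univ fun _ : X => Set.Icc (-(N : ℤ)) N).Finite :=
      Set.Finite.pi' (fun _ => Set.finite_Icc _ _) |>.subset (by intro f hf x; exact hf x trivial)
    have hmaps : Set.MapsTo D Set.univ (Set.pi Set.univ fun _ : X => Set.Icc (-(N : ℤ)) N) := by
      intro k _ x _
      have := hDN k x
      constructor <;> omega
    obtain ⟨i, _, j, _, hne, he⟩ := Set.infinite_univ.exists_ne_map_eq_of_mapsTo hmaps hfin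
    rcases lt_or_gt_of_ne hne with hlt | hlt
    · exact ⟨i, j, hlt, he⟩
    · exact ⟨j, i, hlt, he.symm⟩
  have hw : (pullT g ^ i) w = (pullT g ^ j) w := by
    ext x
    rw [hD, hD, hDij]
  have hpow : ∀ k < n, M ^ (k + 1) ≤ M ^ (2 * n - 1) := by
    intro k hk
    rcases Nat.eq_zero_or_pos M with h0 | h0
    · subst h0; simp
    · exact Nat.pow_le_pow_right h0 (by omega)
  have hB : ∀ k < Fintype.card X, ∀ x, |(((pullT g ^ k) w x : ℚ) : ℝ)| ≤
      (M : ℝ) ^ (2 * n - 1) := by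
    intro k hk x
    rw [← hn] at hk
    rw [hD]
    have hl := length_iterM_le g M hgM k [x]
    have h1 := length_applyM_le g M hgM (iterM g k [x])
    have h2 := length_applyM_le h M hhM (iterM g k [x])
    have h3 : M * (iterM g k [x]).length ≤ M ^ (2 * n - 1) := by
      refine le_trans ?_ (hpow k hk)
      rw [pow_succ']
      exact Nat.mul_le_mul_left _ (by simpa using hl)
    have h4 : |D k x| ≤ ((M ^ (2 * n - 1) : ℕ) : ℤ) := by
      simp only [D]
      rw [abs_le]
      constructor <;> omega
    have h5 : ((|D k x| : ℤ) : ℝ) ≤ (((M ^ (2 * n - 1) : ℕ) : ℤ) : ℝ) := by exact_mod_cast h4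
    push_cast at h5
    simpa using h5
  have hall := linear_bound_aux (pullT g) w i j hij hw _ hB
  rw [← hn] at hall
  have hexp : (n : ℝ) * (n.factorial : ℝ) ≤
      Real.exp ((n : ℝ) ^ 2 * (1 + Real.sqrt (6 * n * Real.log n))) := by
    have h1 : n * n.factorial ≤ n ^ n := by
      obtain ⟨m, rfl⟩ : ∃ m, n = m + 1 := ⟨n - 1, by omega⟩
      rw [pow_succ']
      exact Nat.mul_le_mul_left _ (factorial_succ_le_pow_aux m)
    have h2 : (n : ℝ) ≤ Real.exp n := by linarith [Real.add_one_le_exp (n : ℝ)]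
    calc (n : ℝ) * (n.factorial : ℝ) ≤ (n : ℝ) ^ n := by exact_mod_cast h1
      _ ≤ (Real.exp n) ^ n := by gcongr
      _ = Real.exp ((n : ℝ) ^ 2) := by rw [← Real.exp_nat_mul, sq]
      _ ≤ _ := by
        apply Real.exp_le_exp.mpr
        have := Real.sqrt_nonneg (6 * n * Real.log n)
        exact le_mul_of_one_le_right (by positivity) (by linarith)
  have hbound : ∀ k x, ((D k x).natAbs : ℝ) ≤
      (M : ℝ) ^ (2 * n - 1) * Real.exp ((n : ℝ) ^ 2 * (1 + Real.sqrt (6 * n * Real.log n))) := by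
    intro k x
    have h1 := hall k x
    rw [hD] at h1
    have h2 : ((D k x).natAbs : ℝ) = |(((D k x : ℤ) : ℚ) : ℝ)| := by
      rw [Nat.cast_natAbs]; simp
    rw [h2]
    refine h1.trans ?_
    rw [mul_comm]
    gcongr
  have hfl : BAL g h ≤ ((⌊(M : ℝ) ^ (2 * n - 1) *
      Real.exp ((n : ℝ) ^ 2 * (1 + Real.sqrt (6 * n * Real.log n)))⌋₊ : ℕ) : ℕ∞) := by
    refine iSup₂_le fun x k => ?_
    exact Nat.cast_le.mpr (Nat.le_floor (hbound k x))
  have h6 := ENat.toNat_le_of_le_natCast hfl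
  exact (Nat.cast_le.mpr h6).trans (Nat.floor_le (by positivity))
end

section
/- Let (X, g₁, a) and (X, g₂, a) be 1-systems such that g₁^ω(a) = g₂^ω(a). If (X, g₁g₂, a) and (X, g₂g₁, a) are 1-simple, then there exists a positive integer K such that ||g₁g₂(w)| − |g₂g₁(w)|| ≤ K whenever w is a finite prefix of g₁^ω(a). -/
open Filter Set

variable {X : Type*}

/-- `(X, g, a)` is a 1-system with `g^ω(a) = s`:
(i) `g(a) ∈ a X₁*`, (ii) `g(x) ∈ X₁*` for `x ∈ X₁ = X \ {a}`,
(iii) `{g^i(a) : i ≥ 0}` is infinite, (iv) every `x ∈ X₁` occurs infinitely often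
in `g^ω(a)`. -/
def OneSystem (g : X → List X) (a : X) (s : ℕ → X) : Prop :=
  (∃ w : List X, g a = a :: w ∧ a ∉ w) ∧
  (∀ x : X, x ≠ a → a ∉ g x) ∧
  (Set.range fun i => iterM g i [a]).Infinite ∧
  IsOmega g a s ∧
  (∀ x : X, x ≠ a → {i : ℕ | s i = x}.Infinite)

/-- A 1-system `(X, g, a)` is 1-simple: the restriction of `g` to `X₁ = X \ {a}`
is primitive. -/
def OneSimple (g : X → List X) (a : X) : Prop :=
  ∃ k : ℕ, 0 < k ∧ ∀ b c : X, b ≠ a → c ≠ a → b ∈ iterM g k [c]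


/-! ### Abstract framework: length functions of morphisms fixing an infinite word -/

structure Cpt (s : ℕ → X) (F : ℕ → ℕ) : Prop where
  sm : StrictMono F
  zero : F 0 = 0
  len : ∀ i j, s i = s j → F (i+1) + F j = F (j+1) + F i
  con : ∀ i j r, s i = s j → F i + r < F (i+1) → s (F i + r) = s (F j + r)

def Per (s : ℕ → X) (A B q : ℕ) : Prop := ∀ i, A ≤ i → i + q < B → s i = s (i + q)

lemma Per.sub {s : ℕ → X} {A B A' B' q : ℕ} (h : Per s A B q) (hA : A ≤ A') (hB : B' ≤ B) :
    Per s A' B' q := fun i hi hi' => h i (by omega) (by omega)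

lemma Per.shift {s : ℕ → X} {A B A' B' q m : ℕ} (h : Per s A B q) (hB : B = A + m)
    (hB' : B' = A' + m) (hc : ∀ r < m, s (A + r) = s (A' + r)) : Per s A' B' q := by
  intro i hi hi'
  have h1 := hc (i - A') (by omega)
  have h2 := hc (i + q - A') (by omega)
  have h3 := h (A + (i - A')) (by omega) (by omega)
  have e1 : A' + (i - A') = i := by omega
  have e2 : A' + (i + q - A') = i + q := by omega
  have e3 : A + (i + q - A') = A + (i - A') + q := by omega
  rw [e1] at h1
  rw [e2, e3] at h2
  rw [← h1, ← h2, h3]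

lemma Cpt.seg {s : ℕ → X} {F : ℕ → ℕ} (h : Cpt s F) (i j m : ℕ)
    (hs : ∀ r < m, s (i + r) = s (j + r)) :
    F (i + m) + F j = F (j + m) + F i ∧
      ∀ t, F i + t < F (i + m) → s (F i + t) = s (F j + t) := by
  induction m with
  | zero => simp [add_comm]
  | succ m ih =>
    obtain ⟨h1, h2⟩ := ih (fun r hr => hs r (by omega))
    have e := hs m (by omega)
    have h3 := h.len _ _ e
    have m1 : F i ≤ F (i + m) := h.sm.monotone (by omega)
    have m2 : F j ≤ F (j + m) := h.sm.monotone (by omega)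
    refine ⟨by rw [← add_assoc, ← add_assoc]; omega, ?_⟩
    intro t ht
    by_cases hlt : F i + t < F (i + m)
    · exact h2 t hlt
    · have h4 := h.con _ _ (F i + t - F (i+m)) e (by rw [← add_assoc] at ht; omega)
      have e1 : F (i + m) + (F i + t - F (i + m)) = F i + t := by omega
      have e2 : F (j + m) + (F i + t - F (i + m)) = F j + t := by omega
      rwa [e1, e2] at h4

lemma Cpt.comp {s : ℕ → X} {F G : ℕ → ℕ} (hF : Cpt s F) (hG : Cpt s G) : Cpt s (F ∘ G) where
  sm := hF.sm.comp hG.sm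
  zero := by simp [hG.zero, hF.zero]
  len := by
    intro i j e
    have l := hG.len i j e
    have a1 : G i < G (i+1) := hG.sm (by omega)
    have := (hF.seg (G i) (G j) (G (i+1) - G i)
      (fun r hr => hG.con i j r e (by omega))).1
    have e1 : G i + (G (i+1) - G i) = G (i+1) := by omega
    have e2 : G j + (G (i+1) - G i) = G (j+1) := by omega
    rw [e1, e2] at this
    exact this
  con := by
    intro i j r e hr
    have l := hG.len i j e
    have a1 : G i < G (i+1) := hG.sm (by omega)
    have := (hF.seg (G i) (G j) (G (i+1) - G i)
      (fun r hr => hG.con i j r e (by omega))).2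
    have e1 : G i + (G (i+1) - G i) = G (i+1) := by omega
    rw [e1] at this
    exact this r hr

lemma Cpt.id (s : ℕ → X) : Cpt s id where
  sm := strictMono_id
  zero := rfl
  len := by intro i j _; simp; omega
  con := by
    intro i j r e hr
    have : r = 0 := by simp at hr; omega
    subst this
    simpa using e

lemma Cpt.iter {s : ℕ → X} {F : ℕ → ℕ} (hF : Cpt s F) (k : ℕ) : Cpt s (F^[k]) := by
  induction k with
  | zero => exact Cpt.id s
  | succ k ih => exact ih.comp hF

lemma Cpt.le {s : ℕ → X} {F : ℕ → ℕ} (hF : Cpt s F) (n : ℕ) : n ≤ F n := hF.sm.le_apply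

/-- periodicity of an image -/
lemma Cpt.perImage {s : ℕ → X} {F : ℕ → ℕ} (hF : Cpt s F) {A B q : ℕ} (h : Per s A B q)
    (hAB : A + q ≤ B) : Per s (F A) (F B) (F (A + q) - F A) := by
  have := hF.seg A (A + q) (B - A - q) (fun r hr => by
    have := h (A + r) (by omega) (by omega)
    rw [this]; congr 1; omega)
  obtain ⟨h1, h2⟩ := this
  have m1 : F A ≤ F (A + q) := hF.sm.monotone (by omega)
  have e1 : A + q + (B - A - q) = B := by omega
  rw [e1] at h1
  intro i hi hi'
  have := h2 (i - F A) (by omega)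
  have e2 : F A + (i - F A) = i := by omega
  have e3 : F (A + q) + (i - F A) = i + (F (A + q) - F A) := by omega
  rwa [e2, e3] at this

/-- transport of block periodicity along equal letters -/
lemma Cpt.perLetter {s : ℕ → X} {F : ℕ → ℕ} (hF : Cpt s F) {i j q : ℕ} (e : s i = s j)
    (h : Per s (F i) (F (i+1)) q) : Per s (F j) (F (j+1)) q := by
  have l := hF.len i j e
  have a1 : F i < F (i+1) := hF.sm (by omega)
  exact h.shift (m := F (i+1) - F i) (by omega) (by omega)
    (fun r hr => hF.con i j r e (by omega))

lemma Cpt.perPair {s : ℕ → X} {F : ℕ → ℕ} (hF : Cpt s F) {i j q : ℕ} (e : s i = s j)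
    (e' : s (i+1) = s (j+1))
    (h : Per s (F i) (F (i+2)) q) : Per s (F j) (F (j+2)) q := by
  have a1 : F i < F (i+2) := hF.sm (by omega)
  obtain ⟨h1, h2⟩ := hF.seg i j 2 (fun r hr => by
    interval_cases r
    · simpa using e
    · exact e')
  exact h.shift (m := F (i+2) - F i) (by omega) (by omega)
    (fun r hr => h2 r (by omega))

lemma Per.glue {s : ℕ → X} {A P B A' B' p q : ℕ} (hl : Per s A P p) (hr : Per s P B p)
    (hq : Per s A' B' q) (hpq : p ≤ q) (h1 : A + p + q ≤ P) (h2 : A' + p + q ≤ P)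
    (h3 : P + p ≤ B') : Per s A B p := by
  intro i hi hi'
  by_cases c1 : i + p < P
  · exact hl i hi c1
  by_cases c2 : P ≤ i
  · exact hr i c2 hi'
  have t1 := hq (i - q) (by omega) (by omega)
  have t2 := hq (i + p - q) (by omega) (by omega)
  have t3 := hl (i - q) (by omega) (by omega)
  have e1 : i - q + q = i := by omega
  have e2 : i + p - q + q = i + p := by omega
  have e3 : i - q + p = i + p - q := by omega
  rw [e1] at t1; rw [e2] at t2; rw [e3] at t3
  rw [← t1, t3, t2]

lemma findBlock {Q : ℕ → ℕ} (hQ : StrictMono Q) {u i : ℕ} (h : Q u ≤ i) :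
    ∃ c, u ≤ c ∧ Q c ≤ i ∧ i < Q (c+1) := by
  have hex : ∃ n, i < Q n := ⟨i + 1, lt_of_lt_of_le (Nat.lt_succ_self i) hQ.le_apply⟩
  classical
  have h1 := Nat.find_spec hex
  have hgt : u < Nat.find hex := by
    by_contra hc
    have := hQ.monotone (not_lt.mp hc)
    omega
  have h2 := Nat.find_min hex (m := Nat.find hex - 1) (by omega)
  refine ⟨Nat.find hex - 1, by omega, by omega, ?_⟩
  have : Nat.find hex - 1 + 1 = Nat.find hex := by omega
  rw [this]; exact h1

lemma glueBlocks {s : ℕ → X} {Q : ℕ → ℕ} (hQ : StrictMono Q) {u v p : ℕ}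
    (h1 : ∀ c, u ≤ c → c < v → Per s (Q c) (Q (c+1)) p)
    (h2 : ∀ c, u ≤ c → c + 1 < v → Per s (Q c) (Q (c+2)) p)
    (hlen : ∀ c, u ≤ c → c < v → Q c + p ≤ Q (c+1)) : Per s (Q u) (Q v) p := by
  intro i hi hi'
  obtain ⟨c, hc, hc1, hc2⟩ := findBlock hQ hi
  have hcv : c < v := by
    by_contra hh
    have := hQ.monotone (not_lt.mp hh)
    omega
  by_cases hh : c + 1 < v
  · have := hlen (c+1) (by omega) hh
    exact h2 c hc hh i hc1 (by show i + p < Q (c+1+1); omega)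
  · have : v = c + 1 := by omega
    subst this
    exact h1 c hc hcv i hc1 hi'

lemma Cpt.bdd [Finite X] {s : ℕ → X} {F : ℕ → ℕ} (hF : Cpt s F) :
    ∃ C, ∀ i, F (i+1) ≤ F i + C := by
  have : ∀ x : X, ∃ C, ∀ i, s i = x → F (i+1) ≤ F i + C := by
    intro x
    by_cases hx : ∃ j, s j = x
    · obtain ⟨j, hj⟩ := hx
      refine ⟨F (j+1), fun i hi => ?_⟩
      have := hF.len i j (by rw [hi, hj])
      omega
    · exact ⟨0, fun i hi => absurd ⟨i, hi⟩ hx⟩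
  choose C hC using this
  obtain ⟨D, hD⟩ := (Set.finite_range C).bddAbove
  refine ⟨D, fun i => ?_⟩
  have h1 := hC (s i) i rfl
  have h2 : C (s i) ≤ D := hD ⟨s i, rfl⟩
  omega

lemma slope_le {F : ℕ → ℕ} {C : ℕ} (h : ∀ i, F (i+1) ≤ F i + C) (i m : ℕ) :
    F (i + m) ≤ F i + C * m := by
  induction m with
  | zero => simp
  | succ m ih =>
    have := h (i + m)
    rw [← add_assoc, mul_add]
    omega

/-! ### Frequencies -/

structure ESys (s : ℕ → X) (E : ℕ → ℕ) (C : ℕ) : Prop where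
  cpt : Cpt s E
  bd : ∀ i, E (i+1) ≤ E i + C
  big : ∀ j, 1 ≤ j → E j + 4 ≤ E (j+1)
  all : ∀ j j', 1 ≤ j → 1 ≤ j' → ∃ i, E j ≤ i ∧ i < E (j+1) ∧ s i = s j'
  one : 2 ≤ E 1

/-- real block length -/
def Lr (E : ℕ → ℕ) (k j : ℕ) : ℝ := (E^[k] (j+1) : ℝ) - (E^[k] j : ℝ)

def Addv (s : ℕ → X) (Ψ : ℕ → ℝ) : Prop :=
  ∀ i j, s i = s j → Ψ (i+1) - Ψ i = Ψ (j+1) - Ψ j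

lemma Addv.seg {s : ℕ → X} {Ψ : ℕ → ℝ} (h : Addv s Ψ) (i j m : ℕ)
    (hs : ∀ r < m, s (i + r) = s (j + r)) : Ψ (i + m) - Ψ i = Ψ (j + m) - Ψ j := by
  induction m with
  | zero => simp
  | succ m ih =>
    have h1 := ih (fun r hr => hs r (by omega))
    have h2 := h _ _ (hs m (by omega))
    rw [← add_assoc, ← add_assoc]
    linarith

lemma Addv.comp {s : ℕ → X} {Ψ : ℕ → ℝ} {G : ℕ → ℕ} (h : Addv s Ψ) (hG : Cpt s G) :
    Addv s (fun n => Ψ (G n)) := by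
  intro i j e
  have l := hG.len i j e
  have a1 : G i < G (i+1) := hG.sm (by omega)
  have := h.seg (G i) (G j) (G (i+1) - G i) (fun r hr => hG.con i j r e (by omega))
  have e1 : G i + (G (i+1) - G i) = G (i+1) := by omega
  have e2 : G j + (G (i+1) - G i) = G (j+1) := by omega
  rw [e1, e2] at this
  exact this

lemma Addv.bdd [Finite X] {s : ℕ → X} {Ψ : ℕ → ℝ} (h : Addv s Ψ) :
    ∃ B : ℝ, 0 ≤ B ∧ ∀ i, |Ψ (i+1) - Ψ i| ≤ B := by
  have : ∀ x : X, ∃ C : ℝ, ∀ i, s i = x → |Ψ (i+1) - Ψ i| ≤ C := by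
    intro x
    by_cases hx : ∃ j, s j = x
    · obtain ⟨j, hj⟩ := hx
      exact ⟨|Ψ (j+1) - Ψ j|, fun i hi => by rw [h i j (by rw [hi, hj])]⟩
    · exact ⟨0, fun i hi => absurd ⟨i, hi⟩ hx⟩
  choose C hC using this
  obtain ⟨D, hD⟩ := (Set.finite_range C).bddAbove
  refine ⟨D, ?_, fun i => ?_⟩
  · exact (abs_nonneg _).trans ((hC (s 0) 0 rfl).trans (hD ⟨s 0, rfl⟩))
  · exact (hC (s i) i rfl).trans (hD ⟨s i, rfl⟩)

lemma Cpt.addv {s : ℕ → X} {F : ℕ → ℕ} (h : Cpt s F) : Addv s (fun n => (F n : ℝ)) := by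
  intro i j e
  have := h.len i j e
  have : (F (i+1) : ℝ) + F j = F (j+1) + F i := by exact_mod_cast this
  try simp only
  linarith

lemma tele {f : ℕ → ℝ} {u v : ℕ} (huv : u ≤ v) (h : ∀ c, u ≤ c → c < v → f c ≤ f (c+1)) :
    f u ≤ f v := by
  induction v, huv using Nat.le_induction with
  | base => exact le_rfl
  | succ v hv ih => exact (ih (fun c h1 h2 => h c h1 (by omega))).trans (h v hv (by omega))

lemma tele' {f : ℕ → ℝ} {u v i : ℕ} {e : ℝ} (h : ∀ c, u ≤ c → c < v → f c ≤ f (c+1))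
    (h1 : u ≤ i) (h2 : i < v) (he : f i + e ≤ f (i+1)) : f u + e ≤ f v := by
  have a := tele h1 (f := f) (fun c h3 h4 => h c h3 (by omega))
  have b := tele (show i + 1 ≤ v by omega) (f := f) (fun c h3 h4 => h c (by omega) (by omega))
  linarith

lemma tele_abs {f g : ℕ → ℝ} {u v : ℕ} (huv : u ≤ v)
    (h : ∀ c, u ≤ c → c < v → |f (c+1) - f c| ≤ g (c+1) - g c) : |f v - f u| ≤ g v - g u := by
  have a := tele huv (f := fun c => g c - f c) (fun c h1 h2 => by
    have := (abs_le.mp (h c h1 h2)).2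
    (try simp only); linarith)
  have b := tele huv (f := fun c => g c + f c) (fun c h1 h2 => by
    have := (abs_le.mp (h c h1 h2)).1
    (try simp only); linarith)
  try simp only at a b
  rw [abs_le]; constructor <;> linarith

namespace ESys

variable {s : ℕ → X} {E : ℕ → ℕ} {C : ℕ}

lemma Cpos (h : ESys s E C) : 1 ≤ C := by
  have := h.big 1 le_rfl
  have := h.bd 1
  omega

lemma itge (h : ESys s E C) (k : ℕ) {j : ℕ} (hj : 1 ≤ j) : 1 ≤ E^[k] j :=
  hj.trans ((h.cpt.iter k).le j)

lemma Lr_pos (h : ESys s E C) (k j : ℕ) : 1 ≤ Lr E k j := by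
  have : E^[k] j + 1 ≤ E^[k] (j+1) := (h.cpt.iter k).sm (Nat.lt_succ_self j)
  have : (E^[k] j : ℝ) + 1 ≤ E^[k] (j+1) := by exact_mod_cast this
  unfold Lr; linarith

lemma Lr_letter (h : ESys s E C) (k : ℕ) {i j : ℕ} (e : s i = s j) : Lr E k i = Lr E k j :=
  (h.cpt.iter k).addv i j e

lemma Lr_succ_le (h : ESys s E C) (k j : ℕ) : Lr E (k+1) j ≤ C * Lr E k j := by
  have m : E^[k] j ≤ E^[k] (j+1) := (h.cpt.iter k).sm.monotone (by omega)
  have := slope_le h.bd (E^[k] j) (E^[k] (j+1) - E^[k] j)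
  rw [Nat.add_sub_cancel' m] at this
  unfold Lr
  rw [Function.iterate_succ_apply', Function.iterate_succ_apply']
  have h2 : (E (E^[k] (j+1)) : ℝ) ≤ E (E^[k] j) + C * ((E^[k] (j+1) - E^[k] j : ℕ) : ℝ) := by
    exact_mod_cast this
  rw [Nat.cast_sub m] at h2
  linarith

lemma cmp (h : ESys s E C) (k : ℕ) {j j' : ℕ} (hj : 1 ≤ j) (hj' : 1 ≤ j') :
    Lr E k j ≤ C * Lr E k j' := by
  have hC : (1:ℝ) ≤ C := by exact_mod_cast h.Cpos
  cases k with
  | zero => simpa [Lr] using hC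
  | succ k =>
    obtain ⟨i, h1, h2, e⟩ := h.all j' j hj' hj
    refine (h.Lr_succ_le k j).trans ?_
    have : Lr E k j ≤ Lr E (k+1) j' := by
      rw [← h.Lr_letter k e]
      unfold Lr
      rw [Function.iterate_succ_apply, Function.iterate_succ_apply]
      have a : E^[k] (i+1) ≤ E^[k] (E (j'+1)) := (h.cpt.iter k).sm.monotone (by omega)
      have b : E^[k] (E j') ≤ E^[k] i := (h.cpt.iter k).sm.monotone h1
      have a' : (E^[k] (i+1) : ℝ) ≤ E^[k] (E (j'+1)) := by exact_mod_cast a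
      have b' : (E^[k] (E j') : ℝ) ≤ E^[k] i := by exact_mod_cast b
      linarith
    gcongr

def Bnd (E : ℕ → ℕ) (Ψ : ℕ → ℝ) (k : ℕ) (lo hi : ℝ) : Prop :=
  ∀ j, 1 ≤ j → lo * Lr E k j ≤ Ψ (E^[k] (j+1)) - Ψ (E^[k] j) ∧
    Ψ (E^[k] (j+1)) - Ψ (E^[k] j) ≤ hi * Lr E k j

lemma Bnd.neg {Ψ : ℕ → ℝ} {k : ℕ} {lo hi : ℝ} (hb : Bnd E Ψ k lo hi) :
    Bnd E (fun n => - Ψ n) k (-hi) (-lo) := by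
  intro j hj
  obtain ⟨a, b⟩ := hb j hj
  constructor <;> simp only [neg_mul] <;> linarith

lemma up (h : ESys s E C) {Ψ : ℕ → ℝ} (hΨ : Addv s Ψ) {k : ℕ} {lo hi mid : ℝ}
    (hb : Bnd E Ψ k lo hi) (hm : mid ≤ hi)
    (h1 : Ψ (E^[k] 2) - Ψ (E^[k] 1) ≤ mid * Lr E k 1) :
    ∀ j, 1 ≤ j → Ψ (E^[k+1] (j+1)) - Ψ (E^[k+1] j) ≤
      (hi - (hi - mid) / (C * C)) * Lr E (k+1) j := by
  intro j hj
  have hC : (1:ℝ) ≤ C := by exact_mod_cast h.Cpos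
  obtain ⟨i, i1, i2, e⟩ := h.all j 1 hj le_rfl
  have hEj : 1 ≤ E j := hj.trans (h.cpt.le j)
  have hΔ := (hΨ.comp (h.cpt.iter k)) i 1 e
  simp only [Nat.reduceAdd] at hΔ
  have hL := h.Lr_letter k e
  have t := tele' (f := fun c => hi * E^[k] c - Ψ (E^[k] c)) (u := E j) (v := E (j+1)) (i := i)
    (e := (hi - mid) * Lr E k 1) (fun c c1 c2 => by
      have := (hb c (by omega)).2
      unfold Lr at this
      (try simp only); linarith) i1 i2 (by
      try simp only
      have : hi * E^[k] (i+1) - hi * E^[k] i = hi * Lr E k 1 := by rw [← hL]; unfold Lr; ring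
      linarith)
  simp only [← Function.iterate_succ_apply] at t
  have hl : Lr E (k+1) j ≤ C * C * Lr E k 1 := by
    have a := h.Lr_succ_le k j
    have b := h.cmp k hj (le_refl 1)
    calc _ ≤ _ := a
      _ ≤ C * (C * Lr E k 1) := by gcongr
      _ = _ := by ring
  have h2 : (hi - mid) / (C * C) * Lr E (k+1) j ≤ (hi - mid) * Lr E k 1 := by
    rw [div_mul_eq_mul_div, div_le_iff₀ (by positivity)]
    have : 0 ≤ hi - mid := by linarith
    calc _ ≤ (hi - mid) * (C * C * Lr E k 1) := by gcongr
      _ = _ := by ring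
  have h3 : (hi - (hi - mid) / (C * C)) * Lr E (k+1) j =
      hi * Lr E (k+1) j - (hi - mid) / (C * C) * Lr E (k+1) j := by ring
  rw [h3]
  have h4 : hi * Lr E (k+1) j = hi * E^[k+1] (j+1) - hi * E^[k+1] j := by unfold Lr; ring
  linarith

lemma Bnd.succ (h : ESys s E C) {Ψ : ℕ → ℝ} (hΨ : Addv s Ψ) {k : ℕ} {lo hi : ℝ}
    (hb : Bnd E Ψ k lo hi) : Bnd E Ψ (k+1) lo hi := by
  intro j hj
  have u1 := h.up hΨ hb le_rfl (by simpa using (hb 1 le_rfl).2) j hj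
  have hΨ' : Addv s (fun n => - Ψ n) := fun i j e => by have := hΨ i j e; (try simp only); linarith
  have u2 := h.up hΨ' hb.neg le_rfl (by simpa using (hb.neg 1 le_rfl).2) j hj
  simp only [sub_self, zero_div, sub_zero, neg_mul] at u1 u2
  exact ⟨by linarith, u1⟩

lemma Bnd.mono (h : ESys s E C) {Ψ : ℕ → ℝ} (hΨ : Addv s Ψ) {k k' : ℕ} {lo hi : ℝ}
    (hb : Bnd E Ψ k lo hi) (hk : k ≤ k') : Bnd E Ψ k' lo hi := by
  induction k', hk using Nat.le_induction with
  | base => exact hb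
  | succ n hn ih => exact ih.succ h hΨ

lemma Bnd.le (h : ESys s E C) {Ψ : ℕ → ℝ} (hΨ : Addv s Ψ) {k k' : ℕ} {lo hi lo' hi' : ℝ}
    (hb : Bnd E Ψ k lo hi) (hb' : Bnd E Ψ k' lo' hi') : lo ≤ hi' := by
  have a := (hb.mono h hΨ (le_max_left k k') 1 le_rfl).1
  have b := (hb'.mono h hΨ (le_max_right k k') 1 le_rfl).2
  have p := h.Lr_pos (max k k') 1
  exact le_of_mul_le_mul_right (a.trans b) (by linarith)

lemma contract (h : ESys s E C) {Ψ : ℕ → ℝ} (hΨ : Addv s Ψ) {k : ℕ} {lo hi : ℝ}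
    (hb : Bnd E Ψ k lo hi) : ∃ lo' hi', hi' - lo' ≤ (1 - 1 / (2 * (C * C) : ℝ)) * (hi - lo) ∧
      Bnd E Ψ (k+1) lo' hi' := by
  have hC : (1:ℝ) ≤ C := by exact_mod_cast h.Cpos
  have hlh := hb.le h hΨ hb
  have hb1 := hb.succ h hΨ
  have hΨ' : Addv s (fun n => - Ψ n) := fun i j e => by have := hΨ i j e; (try simp only); linarith
  by_cases hc : Ψ (E^[k] 2) - Ψ (E^[k] 1) ≤ (lo + hi) / 2 * Lr E k 1
  · refine ⟨lo, hi - (hi - (lo + hi) / 2) / (C * C), ?_, fun j hj =>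
      ⟨(hb1 j hj).1, h.up hΨ hb (by linarith) hc j hj⟩⟩
    apply le_of_eq
    field_simp
    ring
  · have u2 := h.up hΨ' hb.neg (mid := - ((lo + hi) / 2)) (by linarith)
      (by rw [neg_mul]; linarith)
    refine ⟨-(-lo - (-lo - -((lo + hi) / 2)) / (C * C)), hi, ?_, fun j hj =>
      ⟨?_, (hb1 j hj).2⟩⟩
    · apply le_of_eq
      field_simp
      ring
    · have := u2 j hj
      rw [neg_mul]
      linarith

lemma freq [Finite X] (h : ESys s E C) {Ψ : ℕ → ℝ} (hΨ : Addv s Ψ) :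
    ∃ c : ℝ, ∀ ε : ℝ, 0 < ε → ∃ k₁, ∀ k, k₁ ≤ k → ∀ j, 1 ≤ j →
      |Ψ (E^[k] (j+1)) - Ψ (E^[k] j) - c * Lr E k j| ≤ ε * Lr E k j := by
  obtain ⟨B, hB0, hB⟩ := hΨ.bdd
  have hC : (1:ℝ) ≤ C := by exact_mod_cast h.Cpos
  have b0 : Bnd E Ψ 0 (-B) B := by
    intro j hj
    have := abs_le.mp (hB j)
    simpa [Lr] using this
  have hn : ∀ n, ∃ lo hi, hi - lo ≤ (1 - 1 / (2 * (C * C) : ℝ))^n * (2 * B) ∧ Bnd E Ψ n lo hi := by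
    intro n
    induction n with
    | zero => exact ⟨-B, B, by simp; linarith, b0⟩
    | succ n ih =>
      obtain ⟨lo, hi, h1, h2⟩ := ih
      obtain ⟨lo', hi', h3, h4⟩ := h.contract hΨ h2
      refine ⟨lo', hi', h3.trans ?_, h4⟩
      rw [pow_succ', mul_assoc]
      apply mul_le_mul_of_nonneg_left h1
      have : 1 / (2 * (C * C) : ℝ) ≤ 1 := by
        rw [div_le_one (by positivity)]
        nlinarith
      linarith
  set S : Set ℝ := {lo | ∃ k hi, Bnd E Ψ k lo hi} with hS
  have hne : S.Nonempty := ⟨-B, 0, B, b0⟩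
  refine ⟨sSup S, fun ε hε => ?_⟩
  have hθ0 : 0 ≤ 1 - 1 / (2 * (C * C) : ℝ) := by
    have : 1 / (2 * (C * C) : ℝ) ≤ 1 := by
      rw [div_le_one (by positivity)]
      nlinarith
    linarith
  have hθ1 : 1 - 1 / (2 * (C * C) : ℝ) < 1 := by
    have : 0 < 1 / (2 * (C * C) : ℝ) := by positivity
    linarith
  have ht : Tendsto (fun n : ℕ => (1 - 1 / (2 * (C * C) : ℝ))^n * (2 * B)) atTop (nhds (0 * (2 * B))) :=
    (tendsto_pow_atTop_nhds_zero_of_lt_one hθ0 hθ1).mul_const _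
  rw [zero_mul] at ht
  obtain ⟨n, hn'⟩ := ((ht.eventually (gt_mem_nhds hε))).exists
  obtain ⟨lo, hi, h1, h2⟩ := hn n
  refine ⟨n, fun k hk j hj => ?_⟩
  have hlo : lo ≤ sSup S := by
    refine le_csSup ⟨B, ?_⟩ ⟨n, hi, h2⟩
    rintro x ⟨k', hi', hx⟩
    exact hx.le h hΨ b0
  have hhi : sSup S ≤ hi := by
    refine csSup_le hne ?_
    rintro x ⟨k', hi', hx⟩
    exact hx.le h hΨ h2
  obtain ⟨a, b⟩ := h2.mono h hΨ hk j hj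
  have p : 0 ≤ Lr E k j := by linarith [h.Lr_pos k j]
  have q1 : (lo - sSup S) * Lr E k j ≥ - ε * Lr E k j := by
    apply mul_le_mul_of_nonneg_right _ p; linarith
  have q2 : (hi - sSup S) * Lr E k j ≤ ε * Lr E k j := by
    apply mul_le_mul_of_nonneg_right _ p; linarith
  rw [abs_le]
  constructor <;> linarith

/-- the frequency governs prefixes -/
lemma freq_pref [Finite X] (h : ESys s E C) {Ψ : ℕ → ℝ} (hΨ : Addv s Ψ) {c ε : ℝ} {k : ℕ}
    (hε : 0 ≤ ε)
    (hk : ∀ j, 1 ≤ j → |Ψ (E^[k] (j+1)) - Ψ (E^[k] j) - c * Lr E k j| ≤ ε * Lr E k j) :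
    ∃ K : ℝ, 0 ≤ K ∧ ∀ n : ℕ, |Ψ n - c * n| ≤ ε * n + K := by
  have hΨ' : Addv s (fun n => Ψ n - c * n) := by
    intro i j e; have := hΨ i j e; push_cast; (try simp only); linarith
  obtain ⟨B, hB0, hB⟩ := hΨ'.bdd
  obtain ⟨D, hD⟩ := (h.cpt.iter k).bdd
  have hlip : ∀ u v, u ≤ v → |(Ψ v - c * v) - (Ψ u - c * u)| ≤ B * v - B * u := by
    intro u v huv
    refine tele_abs huv (f := fun n => Ψ n - c * n) (g := fun n => B * n) (fun i _ _ => ?_)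
    have := hB i
    push_cast at this ⊢
    try simp only at this ⊢
    linarith
  set T := E^[k] 1
  refine ⟨|Ψ 0| + B * T + B * D, by positivity, fun n => ?_⟩
  have h0 : ∀ v, |Ψ v - c * v| ≤ |Ψ 0| + B * v := by
    intro v
    have := hlip 0 v (Nat.zero_le _)
    simp only [Nat.cast_zero, mul_zero, sub_zero] at this
    have := abs_sub_abs_le_abs_sub (Ψ v - c * v) (Ψ 0)
    linarith
  by_cases hn : T ≤ n
  · obtain ⟨i, i1, i2, i3⟩ := findBlock (h.cpt.iter k).sm hn
    have a := tele_abs i1 (f := fun m => Ψ (E^[k] m) - c * E^[k] m) (g := fun m => ε * E^[k] m)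
      (fun m m1 m2 => by
        have := hk m m1
        unfold Lr at this
        try simp only
        convert this using 1
        · congr 1; ring
        · ring)
    have b := hlip _ _ i2
    have cc := h0 T
    have hDi := hD i
    have e1 : (n : ℝ) ≤ E^[k] i + D := by
      have : n ≤ E^[k] i + D := by omega
      exact_mod_cast this
    have e2 : (E^[k] i : ℝ) ≤ n := by exact_mod_cast i2
    have e3 : B * n ≤ B * (E^[k] i + D) := by gcongr
    have e4 : ε * (E^[k] i : ℝ) ≤ ε * n := by gcongr
    have e5 : 0 ≤ ε * (E^[k] 1 : ℝ) := by positivity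
    try simp only at a
    have t1 := abs_add_le ((Ψ n - c * n) - (Ψ (E^[k] i) - c * E^[k] i)) (Ψ (E^[k] i) - c * E^[k] i)
    have t2 := abs_add_le ((Ψ (E^[k] i) - c * E^[k] i) - (Ψ (E^[k] 1) - c * E^[k] 1))
      (Ψ (E^[k] 1) - c * E^[k] 1)
    simp only [sub_add_cancel] at t1 t2
    simp only [T] at cc ⊢
    linarith
  · have cc := h0 n
    have : (n : ℝ) ≤ T := by exact_mod_cast (by omega : n ≤ T)
    have e3 : B * n ≤ B * T := by gcongr
    have : 0 ≤ ε * n := by positivity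
    have : 0 ≤ B * D := by positivity
    linarith

lemma growth (h : ESys s E C) (k : ℕ) : (E^[k] 1 : ℝ) ≤ (E 1 * C * C : ℕ) * Lr E k 1 := by
  have hC : (1:ℝ) ≤ C := by exact_mod_cast h.Cpos
  have hE : (2:ℝ) ≤ E 1 := by exact_mod_cast h.one
  induction k with
  | zero =>
    simp [Lr]
    nlinarith [mul_nonneg (by linarith : (0:ℝ) ≤ C - 1) (by linarith : (0:ℝ) ≤ C),
      mul_nonneg (by linarith : (0:ℝ) ≤ E 1 - 2) (by positivity : (0:ℝ) ≤ C * C)]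
  | succ k ih =>
    obtain ⟨i, i1, i2, e⟩ := h.all 1 1 le_rfl le_rfl
    have hL := h.Lr_letter k e
    have hp := h.Lr_pos k 1
    have t := tele' (f := fun c => C * E^[k] c - Lr E k 1 * c) (u := E 1) (v := E 2) (i := i)
      (e := (C - 1) * Lr E k 1) (fun c c1 c2 => by
        have := h.cmp k le_rfl (show 1 ≤ c by have := h.one; omega)
        unfold Lr at this ⊢
        push_cast
        linarith) i1 i2 (by
        push_cast
        have : (C:ℝ) * E^[k] (i+1) - C * E^[k] i = C * Lr E k 1 := by rw [← hL]; unfold Lr; ring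
        linarith)
    have b4 : (E 1 : ℝ) + 4 ≤ E 2 := by exact_mod_cast h.big 1 le_rfl
    simp only [← Function.iterate_succ_apply] at t
    have key : (C + 3) * Lr E k 1 ≤ C * Lr E (k+1) 1 := by
      have : C * Lr E (k+1) 1 = C * E^[k+1] 2 - C * E^[k+1] 1 := by unfold Lr; ring
      rw [this]
      nlinarith
    have u := tele (show 1 ≤ E 1 by have := h.one; omega)
      (f := fun c => C * Lr E k 1 * c - E^[k] c) (fun c c1 c2 => by
        have := h.cmp k c1 le_rfl
        push_cast
        have e : Lr E k c = E^[k] (c+1) - E^[k] c := rfl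
        linarith)
    simp only [← Function.iterate_succ_apply] at u
    push_cast at ih u ⊢
    have : (E 1 : ℝ) * C * ((C + 3) * Lr E k 1) ≤ E 1 * C * (C * Lr E (k+1) 1) := by gcongr
    have p1 : 0 ≤ (E 1 : ℝ) * C * Lr E k 1 := by positivity
    have p2 : 0 ≤ C * Lr E k 1 := by positivity
    nlinarith

lemma Lr_ge (h : ESys s E C) (k : ℕ) {j : ℕ} (hj : 1 ≤ j) : (k : ℝ) ≤ Lr E k j := by
  have : ∀ j, 1 ≤ j → E^[k] j + k ≤ E^[k] (j+1) := by
    induction k with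
    | zero => intro j _; simp
    | succ k ih =>
      intro j hj
      have := ih (E j) (hj.trans (h.cpt.le j))
      have h2 := h.big j hj
      have h3 : E^[k] (E j + 1) < E^[k] (E (j+1)) := (h.cpt.iter k).sm (by omega)
      rw [Function.iterate_succ_apply, Function.iterate_succ_apply]
      omega
  have := this j hj
  have : (E^[k] j : ℝ) + k ≤ E^[k] (j+1) := by exact_mod_cast this
  unfold Lr; linarith

end ESys

lemma two_fun_little [Finite X] {s : ℕ → X} {E : ℕ → ℕ} {C : ℕ} (h : ESys s E C)
    {G₁ G₂ : ℕ → ℕ} (h1 : Cpt s G₁) (h2 : Cpt s G₂) :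
    ∀ ε : ℝ, 0 < ε → ∃ K : ℝ, 0 ≤ K ∧ ∀ n : ℕ,
      |(((G₁ (G₂ n) : ℤ) - (G₂ (G₁ n) : ℤ) : ℤ) : ℝ)| ≤ ε * n + K := by
  intro ε hε
  obtain ⟨c1, hc1⟩ := h.freq h1.addv
  obtain ⟨c2, hc2⟩ := h.freq h2.addv
  obtain ⟨B1, hB1⟩ := h1.bdd
  obtain ⟨B2, hB2⟩ := h2.bdd
  have key : ∀ ε : ℝ, 0 < ε → ∃ K : ℝ, 0 ≤ K ∧ ∀ n : ℕ,
      |(G₁ n : ℝ) - c1 * n| ≤ ε * n + K ∧ |(G₂ n : ℝ) - c2 * n| ≤ ε * n + K := by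
    intro ε hε
    obtain ⟨k1, hk1⟩ := hc1 ε hε
    obtain ⟨k2, hk2⟩ := hc2 ε hε
    obtain ⟨K1, hK1, hK1'⟩ := h.freq_pref h1.addv hε.le (hk1 k1 le_rfl)
    obtain ⟨K2, hK2, hK2'⟩ := h.freq_pref h2.addv hε.le (hk2 k2 le_rfl)
    exact ⟨K1 + K2, by positivity, fun n => ⟨by linarith [hK1' n], by linarith [hK2' n]⟩⟩
  have p1 := abs_nonneg c1
  have p2 := abs_nonneg c2
  set Z : ℝ := B1 + B2 + |c1| + |c2| + 1 with hZ
  have hZpos : 0 < Z := by positivity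
  obtain ⟨K, hK, hn⟩ := key (ε / Z) (by positivity)
  refine ⟨K * (2 + |c1| + |c2|), by positivity, fun n => ?_⟩
  have a1 := (hn (G₂ n)).1
  have a2 := (hn (G₁ n)).2
  have a3 := (hn n).1
  have a4 := (hn n).2
  have g1 : (G₁ n : ℝ) ≤ B1 * n := by
    have := slope_le hB1 0 n
    rw [h1.zero] at this; simp only [zero_add] at this
    exact_mod_cast this
  have g2 : (G₂ n : ℝ) ≤ B2 * n := by
    have := slope_le hB2 0 n
    rw [h2.zero] at this; simp only [zero_add] at this
    exact_mod_cast this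
  have b3 : |c2 * ((G₁ n : ℝ) - c1 * n)| ≤ |c2| * (ε / Z * n + K) := by
    rw [abs_mul]; gcongr
  have b4 : |c1 * ((G₂ n : ℝ) - c2 * n)| ≤ |c1| * (ε / Z * n + K) := by
    rw [abs_mul]; gcongr
  have q1 : ε / Z * (G₁ n : ℝ) ≤ ε / Z * (B1 * n) := by gcongr
  have q2 : ε / Z * (G₂ n : ℝ) ≤ ε / Z * (B2 * n) := by gcongr
  have fin : ε / Z * (B1 * n) + ε / Z * (B2 * n) + |c1| * (ε / Z * n) + |c2| * (ε / Z * n)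
      + ε / Z * n = ε * n := by
    have : ε / Z * (B1 * n) + ε / Z * (B2 * n) + |c1| * (ε / Z * n) + |c2| * (ε / Z * n)
      + ε / Z * n = ε / Z * Z * n := by rw [hZ]; ring
    rw [this, div_mul_cancel₀ _ hZpos.ne']
  have q3 : 0 ≤ ε / Z * n := by positivity
  push_cast
  rw [abs_le] at a1 a2 b3 b4 ⊢
  constructor <;> linarith [a1.1, a1.2, a2.1, a2.2, b3.1, b3.2, b4.1, b4.2]

lemma small_gen [Finite X] {s : ℕ → X} {E : ℕ → ℕ} {C : ℕ} (h : ESys s E C) {d : ℕ → ℤ}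
    (hadd : Addv s (fun n => (d n : ℝ)))
    (hlit : ∀ ε : ℝ, 0 < ε → ∃ K : ℝ, 0 ≤ K ∧ ∀ n : ℕ, |(d n : ℝ)| ≤ ε * n + K) (M J : ℕ) :
    ∃ k₁, ∀ k, k₁ ≤ k → ∃ η : ℕ, 1 ≤ η ∧
      (∀ i, 1 ≤ i → E^[k] i + M * η ≤ E^[k] (i+1)) ∧
      (∀ j, 1 ≤ j → j ≤ J → |d (E^[k] j)| ≤ η) ∧
      (∀ j, 1 ≤ j → ∀ r, r ≤ J → |d (E^[k] (j + r)) - d (E^[k] j)| ≤ η) := by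
  have hC : (1:ℝ) ≤ C := by exact_mod_cast h.Cpos
  obtain ⟨c, hc⟩ := h.freq hadd
  have hc0 : c = 0 := by
    by_contra hne
    have hpos : 0 < |c| := abs_pos.mpr hne
    obtain ⟨k1, hk1⟩ := hc (|c| / 4) (by positivity)
    obtain ⟨K1, hK1, hK1'⟩ := h.freq_pref hadd (by positivity) (hk1 k1 le_rfl)
    obtain ⟨K2, hK2, hK2'⟩ := hlit (|c| / 4) (by positivity)
    obtain ⟨n, hn⟩ := exists_nat_gt (2 * (K1 + K2) / |c|)
    rw [div_lt_iff₀ hpos] at hn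
    have a := hK1' n
    have b := hK2' n
    have t := abs_sub_abs_le_abs_sub (c * n) (d n : ℝ)
    rw [abs_sub_comm, abs_mul, Nat.abs_cast] at t
    linarith
  subst hc0
  set D : ℝ := ((E 1 * C * C : ℕ) : ℝ) with hD
  have hD0 : 0 ≤ D := by positivity
  set W : ℝ := 2 * C * M * (D + J * C) + 1 with hW
  have hWpos : 0 < W := by positivity
  set ε : ℝ := 1 / W with hε
  have hεpos : 0 < ε := by positivity
  obtain ⟨k1, hk1⟩ := hc ε hεpos
  obtain ⟨K, hK, hK'⟩ := hlit ε hεpos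
  obtain ⟨k2, hk2⟩ := exists_nat_gt (2 * C * M * (K + 1))
  refine ⟨max k1 k2, fun k hk => ?_⟩
  have hka : k1 ≤ k := (le_max_left _ _).trans hk
  have hkb : (k2:ℝ) ≤ k := by exact_mod_cast (le_max_right _ _).trans hk
  have hL : (k:ℝ) ≤ Lr E k 1 := h.Lr_ge k le_rfl
  have hLp := h.Lr_pos k 1
  set L := Lr E k 1 with hLdef
  set y : ℝ := ε * (D + J * C) * L + K with hy
  have hy0 : 0 ≤ y := by positivity
  have hfl := Nat.floor_le hy0
  have hfl2 := (Nat.lt_floor_add_one y).le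
  have hstep : ∀ j, 1 ≤ j → |(d (E^[k] (j+1)) : ℝ) - d (E^[k] j)| ≤ ε * (C * L) := by
    intro j hj
    have a := hk1 k hka j hj
    have b := h.cmp k hj le_rfl
    simp only [zero_mul, sub_zero] at a
    exact a.trans (by gcongr)
  have hmany : ∀ j, 1 ≤ j → ∀ r, r ≤ J → |(d (E^[k] (j + r)) : ℝ) - d (E^[k] j)|
      ≤ ε * (C * L) * J := by
    intro j hj r hr
    have := tele_abs (show j ≤ j + r by omega) (f := fun m => (d (E^[k] m) : ℝ))
      (g := fun m => ε * (C * L) * m) (fun m m1 m2 => by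
        have := hstep m (by omega)
        push_cast
        linarith)
    push_cast at this
    refine this.trans ?_
    have : ε * (C * L) * (r:ℝ) ≤ ε * (C * L) * J := by gcongr
    linarith
  have hMy : C * M * (y + 1) ≤ L := by
    have e1 : 2 * (C * M * (ε * (D + J * C) * L)) = (W - 1) * ε * L := by rw [hW]; ring
    have e2 : W * ε = 1 := by rw [hε]; field_simp
    have e3 : (W - 1) * ε ≤ 1 := by linarith
    have e4 : (W - 1) * ε * L ≤ 1 * L := by gcongr
    rw [hy]
    nlinarith
  refine ⟨⌊y⌋₊ + 1, by omega, ?_, ?_, ?_⟩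
  · intro i hi
    have a := h.cmp k le_rfl hi
    have b : (C:ℝ) * (M * ((⌊y⌋₊:ℝ) + 1)) ≤ C * Lr E k i := by
      calc (C:ℝ) * (M * ((⌊y⌋₊:ℝ) + 1)) ≤ C * (M * (y + 1)) := by gcongr
        _ = C * M * (y + 1) := by ring
        _ ≤ _ := hMy.trans a
    have c := le_of_mul_le_mul_left b (by linarith)
    unfold Lr at c
    have : ((E^[k] i + M * (⌊y⌋₊ + 1) : ℕ) : ℝ) ≤ (E^[k] (i+1) : ℕ) := by
      push_cast; linarith
    exact_mod_cast this
  · intro j hj hjJ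
    have a := hmany 1 le_rfl (j - 1) (by omega)
    rw [show 1 + (j - 1) = j by omega] at a
    have b := hK' (E^[k] 1)
    have g := h.growth k
    have g' : ε * (E^[k] 1 : ℝ) ≤ ε * (D * L) := by gcongr
    have t := abs_sub_abs_le_abs_sub (d (E^[k] j) : ℝ) (d (E^[k] 1))
    have : |(d (E^[k] j) : ℝ)| ≤ ((⌊y⌋₊ + 1 : ℕ) : ℝ) := by
      push_cast
      have : y = ε * (D * L) + ε * (C * L) * J + K := by rw [hy]; ring
      linarith
    exact_mod_cast this
  · intro j hj r hr
    have a := hmany j hj r hr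
    have : |(d (E^[k] (j + r)) : ℝ) - d (E^[k] j)| ≤ ((⌊y⌋₊ + 1 : ℕ) : ℝ) := by
      push_cast
      have : y = ε * (D * L) + ε * (C * L) * J + K := by rw [hy]; ring
      have : 0 ≤ ε * (D * L) := by positivity
      linarith
    exact_mod_cast this

/-! ### Combinatorial part -/

def dd (F H : ℕ → ℕ) (n : ℕ) : ℤ := (F n : ℤ) - (H n : ℤ)

structure Big (s : ℕ → X) (F H E T : ℕ → ℕ) (C : ℕ) : Prop where
  e : ESys s E C
  cF : Cpt s F
  cH : Cpt s H
  cT : Cpt s T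
  bF : ∀ i, F (i+1) ≤ F i + C
  bH : ∀ i, H (i+1) ≤ H i + C
  bT : ∀ i, T (i+1) ≤ T i + C
  comm : ∀ n, F (E n) = E (F n)
  ET : ∀ n, E n = T (F n)
  p2 : ∀ j j', 1 ≤ j → 1 ≤ j' → ∃ i, 1 ≤ i ∧ E j ≤ F i ∧ F (i+1) ≤ E (j+1) ∧ s i = s j'
  small : ∀ M J : ℕ, ∃ k₁, ∀ k, k₁ ≤ k → ∃ η : ℕ, 1 ≤ η ∧
      (∀ i, 1 ≤ i → E^[k] i + M * η ≤ E^[k] (i+1)) ∧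
      (∀ j, 1 ≤ j → j ≤ J → |dd F H (E^[k] j)| ≤ η) ∧
      (∀ j, 1 ≤ j → ∀ r, r ≤ J → |dd F H (E^[k] (j + r)) - dd F H (E^[k] j)| ≤ η)

namespace ESys

variable {s : ℕ → X} {E : ℕ → ℕ} {C : ℕ}

lemma allIter (h : ESys s E C) (m j j' : ℕ) (hj : 1 ≤ j) (hj' : 1 ≤ j') :
    ∃ i, E^[m+1] j ≤ i ∧ i < E^[m+1] (j+1) ∧ s i = s j' := by
  obtain ⟨i, h1, h2, h3⟩ := h.all (E^[m] j) j' (h.itge m hj) hj'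
  refine ⟨i, ?_, ?_, h3⟩
  · rw [Function.iterate_succ_apply']; exact h1
  · rw [Function.iterate_succ_apply']
    refine h2.trans_le (h.cpt.sm.monotone ?_)
    exact (h.cpt.iter m).sm (Nat.lt_succ_self j)

lemma occ (h : ESys s E C) (i : ℕ) : ∃ j, i ≤ j ∧ 1 ≤ j ∧ j ≤ i + 2 * C ∧ s j = s 1 := by
  have b0 := h.bd 0
  have b1 := h.bd 1
  rw [h.cpt.zero] at b0
  simp only [zero_add, Nat.reduceAdd] at b0 b1
  by_cases hi : E 1 ≤ i
  · obtain ⟨c, c1, c2, c3⟩ := findBlock h.cpt.sm hi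
    obtain ⟨j, j1, j2, j3⟩ := h.all (c+1) 1 (by omega) le_rfl
    have b2 := h.bd c
    have b3 := h.bd (c+1)
    exact ⟨j, by omega, by omega, by omega, j3⟩
  · obtain ⟨j, j1, j2, j3⟩ := h.all 1 1 le_rfl le_rfl
    have := h.one
    simp only [Nat.reduceAdd] at j2
    exact ⟨j, by omega, by omega, by omega, j3⟩

lemma prevocc (h : ESys s E C) {j : ℕ} (hj : 1 < j) :
    ∃ j', 1 ≤ j' ∧ j' < j ∧ j ≤ j' + 2 * C ∧ s j' = s 1 := by
  have b0 := h.bd 0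
  have b1 := h.bd 1
  rw [h.cpt.zero] at b0
  simp only [zero_add, Nat.reduceAdd] at b0 b1
  by_cases hi : E 2 ≤ j
  · obtain ⟨c, c1, c2, c3⟩ := findBlock h.cpt.sm hi
    obtain ⟨c, rfl⟩ : ∃ c', c = c' + 1 := ⟨c - 1, by omega⟩
    obtain ⟨j', j1, j2, j3⟩ := h.all c 1 (by omega) le_rfl
    have b2 := h.bd c
    have b3 := h.bd (c+1)
    have := h.cpt.le c
    exact ⟨j', by omega, by omega, by omega, j3⟩
  · exact ⟨1, le_rfl, hj, by omega, rfl⟩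

lemma lenshift (h : ESys s E C) (t m i : ℕ) :
    E^[t+m] (i+1) ≤ E^[t+m] i + C^m * (E^[t] (i+1) - E^[t] i) := by
  have m0 : E^[t] i < E^[t] (i+1) := (h.cpt.iter t).sm (Nat.lt_succ_self i)
  induction m with
  | zero => simp; omega
  | succ m ih =>
    rw [← add_assoc, Function.iterate_succ_apply', Function.iterate_succ_apply']
    have m1 : E^[t+m] i < E^[t+m] (i+1) := (h.cpt.iter _).sm (Nat.lt_succ_self i)
    have := slope_le h.bd (E^[t+m] i) (E^[t+m] (i+1) - E^[t+m] i)
    rw [Nat.add_sub_cancel' m1.le] at this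
    have h2 : C * (E^[t+m] (i+1) - E^[t+m] i) ≤ C * (C^m * (E^[t] (i+1) - E^[t] i)) := by
      apply Nat.mul_le_mul_left; omega
    have h3 : C^(m+1) * (E^[t] (i+1) - E^[t] i) = C * (C^m * (E^[t] (i+1) - E^[t] i)) := by ring
    omega

/-- two-letter words internal to a level `n` block -/
def pairs (s : ℕ → X) (E : ℕ → ℕ) (n : ℕ) : Set (X × X) :=
  {p | ∃ j i, 1 ≤ j ∧ E^[n] j ≤ i ∧ i + 1 < E^[n] (j+1) ∧ p = (s i, s (i+1))}

lemma pairs_all (h : ESys s E C) {n : ℕ} {p : X × X} (hp : p ∈ pairs s E n) (j' : ℕ)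
    (hj' : 1 ≤ j') :
    ∃ i, E^[n+1] j' ≤ i ∧ i + 1 < E^[n+1] (j'+1) ∧ p = (s i, s (i+1)) := by
  obtain ⟨j, i, hj, i1, i2, rfl⟩ := hp
  obtain ⟨i0, a1, a2, a3⟩ := h.all j' j hj' hj
  have l := (h.cpt.iter n).len i0 j a3
  have c1 := (h.cpt.iter n).con j i0 (i - E^[n] j) a3.symm (by omega)
  have c2 := (h.cpt.iter n).con j i0 (i + 1 - E^[n] j) a3.symm (by omega)
  have m1 : E^[n] (E j') ≤ E^[n] i0 := (h.cpt.iter n).sm.monotone a1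
  have m2 : E^[n] (i0+1) ≤ E^[n] (E (j'+1)) := (h.cpt.iter n).sm.monotone a2
  refine ⟨E^[n] i0 + (i - E^[n] j), ?_, ?_, ?_⟩
  · rw [Function.iterate_succ_apply]; omega
  · rw [Function.iterate_succ_apply]; omega
  · rw [Nat.add_sub_cancel' i1] at c1
    rw [show E^[n] j + (i + 1 - E^[n] j) = i + 1 by omega,
      show E^[n] i0 + (i + 1 - E^[n] j) = E^[n] i0 + (i - E^[n] j) + 1 by omega] at c2
    rw [c1, c2]

lemma pairs_stab [Finite X] (h : ESys s E C) : ∃ q, ∀ n, pairs s E n ⊆ pairs s E q := by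
  have hm : Monotone (pairs s E) := by
    apply monotone_nat_of_le_succ
    intro n p hp
    obtain ⟨i, h1, h2, h3⟩ := h.pairs_all hp 1 le_rfl
    exact ⟨1, i, le_rfl, h1, h2, h3⟩
  obtain ⟨q, hq⟩ := WellFoundedGT.monotone_chain_condition (⟨pairs s E, hm⟩ : ℕ →o Set (X × X))
  refine ⟨q, fun n => ?_⟩
  have := hq (max q n) (le_max_left _ _)
  simp only [OrderHom.coe_mk] at this
  rw [this]
  exact hm (le_max_right _ _)

/-- a long enough periodic block forces all blocks to be periodic -/
lemma uniform (h : ESys s E C) {q t m p : ℕ} (hq : ∀ n, pairs s E n ⊆ pairs s E q) (hm : 1 ≤ m)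
    (hper : Per s (E^[t+(q+1)] m) (E^[t+(q+1)] (m+1)) p)
    (hlen : ∀ i, 1 ≤ i → E^[t] i + p ≤ E^[t] (i+1)) :
    ∀ n j, 1 ≤ j → Per s (E^[n] j) (E^[n] (j+1)) p := by
  have ht := h.cpt.iter t
  rw [Function.iterate_add_apply E t (q+1) m, Function.iterate_add_apply E t (q+1) (m+1)] at hper
  have single : ∀ c, 1 ≤ c → Per s (E^[t] c) (E^[t] (c+1)) p := by
    intro c hc
    obtain ⟨i, i1, i2, i3⟩ := h.allIter q m c hm hc
    exact ht.perLetter i3 (hper.sub (ht.sm.monotone i1) (ht.sm.monotone i2))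
  have hbig : ∀ n j, 1 ≤ j → Per s (E^[t+n] j) (E^[t+n] (j+1)) p := by
    intro n j hj
    rw [Function.iterate_add_apply, Function.iterate_add_apply]
    have hj1 := h.itge n hj
    apply glueBlocks ht.sm
    · intro c c1 _; exact single c (by omega)
    · intro c c1 c2
      have hmem : (s c, s (c+1)) ∈ pairs s E n := ⟨j, c, hj, c1, c2, rfl⟩
      obtain ⟨i, i1, i2, i3⟩ := h.pairs_all (hq n hmem) m hm
      rw [Prod.mk.injEq] at i3
      exact ht.perPair i3.1.symm i3.2.symm
        (hper.sub (ht.sm.monotone i1) (ht.sm.monotone i2))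
    · intro c c1 _; exact hlen c (by omega)
  intro n j hj
  by_cases hn : t ≤ n
  · have := hbig (n - t) j hj
    rwa [Nat.add_sub_cancel' hn] at this
  · obtain ⟨r, rfl⟩ : ∃ r, t = n + (r + 1) := ⟨t - n - 1, by omega⟩
    obtain ⟨i, i1, i2, i3⟩ := h.allIter r 1 j le_rfl hj
    have b := hbig 0 1 le_rfl
    rw [add_zero, Function.iterate_add_apply E n (r+1) 1, Function.iterate_add_apply E n (r+1) (1+1)] at b
    exact (h.cpt.iter n).perLetter i3
      (b.sub ((h.cpt.iter n).sm.monotone i1) ((h.cpt.iter n).sm.monotone i2))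

end ESys

namespace Big

variable {s : ℕ → X} {F H E T : ℕ → ℕ} {C : ℕ}

lemma commIter (b : Big s F H E T C) (k n : ℕ) : F (E^[k] n) = E^[k] (F n) := by
  induction k generalizing n with
  | zero => rfl
  | succ k ih => rw [Function.iterate_succ_apply, ih, b.comm, ← Function.iterate_succ_apply]

lemma lip (b : Big s F H E T C) (u m : ℕ) : |dd F H (u + m) - dd F H u| ≤ C * m := by
  have h1 := slope_le b.bF u m
  have h2 := slope_le b.bH u m
  have h3 : F u ≤ F (u + m) := b.cF.sm.monotone (by omega)
  have h4 : H u ≤ H (u + m) := b.cH.sm.monotone (by omega)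
  unfold dd
  zify at h1 h2 h3 h4
  rw [abs_le]; constructor <;> linarith

lemma letter (b : Big s F H E T C) {i j : ℕ} (e : s i = s j) :
    dd F H (i+1) - dd F H i = dd F H (j+1) - dd F H j := by
  have h1 := b.cF.len i j e
  have h2 := b.cH.len i j e
  unfold dd
  omega

lemma bounded_of (b : Big s F H E T C) {N : ℕ} {K : ℤ} (h : ∀ n, N ≤ n → |dd F H n| ≤ K) :
    ∃ K : ℤ, ∀ n, |dd F H n| ≤ K := by
  have hK : 0 ≤ K := (abs_nonneg _).trans (h N le_rfl)
  refine ⟨K + C * N, fun n => ?_⟩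
  by_cases hn : N ≤ n
  · have := h n hn
    have : (0:ℤ) ≤ C * N := by positivity
    linarith
  · have := b.lip 0 n
    have h0 : dd F H 0 = 0 := by unfold dd; rw [b.cF.zero, b.cH.zero]; simp
    rw [zero_add, h0, sub_zero] at this
    have : (C:ℤ) * n ≤ C * N := by
      apply mul_le_mul_of_nonneg_left _ (by positivity)
      exact_mod_cast (by omega : n ≤ N)
    linarith

lemma caseI [Finite X] (b : Big s F H E T C) {k : ℕ}
    (h : ∀ j, 1 ≤ j → s j = s 1 → dd F H (E^[k] j) = dd F H (E^[k] 1)) :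
    ∃ K : ℤ, ∀ n, |dd F H n| ≤ K := by
  obtain ⟨D, hD⟩ := (b.e.cpt.iter k).bdd
  apply b.bounded_of (N := E^[k] 1) (K := |dd F H (E^[k] 1)| + C * (D * (2 * C + 1) : ℕ))
  intro n hn
  obtain ⟨i, i1, i2, i3⟩ := findBlock (b.e.cpt.iter k).sm hn
  obtain ⟨j, j1, j2, j3, j4⟩ := b.e.occ (i+1)
  have a1 := slope_le hD i (j - i)
  have a2 := hD i
  rw [show i + (j - i) = j by omega] at a1
  have a3 : E^[k] (i+1) ≤ E^[k] j := (b.e.cpt.iter k).sm.monotone j1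
  have l := b.lip n (E^[k] j - n)
  rw [Nat.add_sub_cancel' (by omega), h j j2 j4] at l
  have a5 : D * (j - i) ≤ D * (2 * C + 1) := Nat.mul_le_mul_left _ (by omega)
  have a6 : E^[k] j - n ≤ D * (2 * C + 1) := by omega
  have a7 : (C:ℤ) * (E^[k] j - n : ℕ) ≤ C * (D * (2 * C + 1) : ℕ) :=
    mul_le_mul_of_nonneg_left (by exact_mod_cast a6) (by positivity)
  have a8 := abs_sub_abs_le_abs_sub (dd F H n) (dd F H (E^[k] 1))
  rw [abs_sub_comm] at a8
  linarith

end Big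

namespace Big

variable {s : ℕ → X} {F H E T : ℕ → ℕ} {C : ℕ}

lemma stretch (b : Big s F H E T C) {k' j j' η : ℕ} (hj : 1 ≤ j)
    (e : s j = s j')
    (h1 : |dd F H (E^[k'+1] j)| ≤ η) (h2 : |dd F H (E^[k'+1] j')| ≤ η)
    (h3 : |dd F H (E^[k'+1] (j+1)) - dd F H (E^[k'+1] j)| ≤ η)
    (hne : dd F H (E^[k'+1] j) ≠ dd F H (E^[k'+1] j'))
    (hlen : ∀ i, 1 ≤ i → E^[k'] i + 4 * η ≤ E^[k'] (i+1)) :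
    ∃ p m, 0 < p ∧ p ≤ 2 * η ∧ 1 ≤ m ∧ Per s (E^[k'] m) (E^[k'] (m+1)) p := by
  have cF := b.cF.comp (b.e.cpt.iter (k'+1))
  have cH := b.cH.comp (b.e.cpt.iter (k'+1))
  have fF := cF.con j j'
  have fH := cH.con j j'
  simp only [Function.comp_apply] at fF fH
  have P1 := b.commIter (k'+1) j
  have P2 := b.commIter (k'+1) (j+1)
  rw [Function.iterate_succ_apply E k' (F j)] at P1
  rw [Function.iterate_succ_apply E k' (F (j+1))] at P2
  have hFj : 1 ≤ F j := hj.trans (b.cF.le j)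
  have hm : 1 ≤ E (F j) := hFj.trans (b.e.cpt.le _)
  have big := b.e.big (F j) hFj
  have hFs : F j + 1 ≤ F (j+1) := b.cF.sm (Nat.lt_succ_self j)
  have hE : E (F j + 1) ≤ E (F (j+1)) := b.e.cpt.sm.monotone hFs
  have l0 := hlen (E (F j)) hm
  have l2 := hlen (E (F j) + 1 + 1) (by omega)
  have l3 : E^[k'] (E (F j) + 1 + 1 + 1) ≤ E^[k'] (E (F (j+1))) :=
    (b.e.cpt.iter k').sm.monotone (by omega)
  unfold dd at h1 h2 h3 hne
  rw [abs_le] at h1 h2 h3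
  refine ⟨(dd F H (E^[k'+1] j) - dd F H (E^[k'+1] j')).natAbs, E (F j) + 1, ?_, ?_, by omega, ?_⟩
  · unfold dd; omega
  · unfold dd; omega
  generalize hp : (dd F H (E^[k'+1] j) - dd F H (E^[k'+1] j')).natAbs = p
  unfold dd at hp
  intro i i1 i2
  rcases lt_or_gt_of_ne hne with hlt | hgt
  · skip
    have a1 := fH (i + p - H (E^[k'+1] j)) e (by omega)
    have a2 := fF (i - F (E^[k'+1] j)) e (by omega)
    rw [show H (E^[k'+1] j) + (i + p - H (E^[k'+1] j)) = i + p by omega] at a1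
    rw [show F (E^[k'+1] j) + (i - F (E^[k'+1] j)) = i by omega] at a2
    rw [a1, a2]
    congr 1
    omega
  · have a1 := fF (i + p - F (E^[k'+1] j)) e (by omega)
    have a2 := fH (i - H (E^[k'+1] j)) e (by omega)
    rw [show F (E^[k'+1] j) + (i + p - F (E^[k'+1] j)) = i + p by omega] at a1
    rw [show H (E^[k'+1] j) + (i - H (E^[k'+1] j)) = i by omega] at a2
    rw [a1, a2]
    congr 1
    omega

lemma lemB [Finite X] (b : Big s F H E T C)
    (h : ∀ k, ∃ j, 1 ≤ j ∧ s j = s 1 ∧ dd F H (E^[k] j) ≠ dd F H (E^[k] 1)) :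
    ∃ p, 0 < p ∧ ∀ n j, 1 ≤ j → Per s (E^[n] j) (E^[n] (j+1)) p := by
  obtain ⟨q, hq⟩ := b.e.pairs_stab
  obtain ⟨k₁, hk₁⟩ := b.small (2 * 4 * C^(q+2)) (2*C+1)
  obtain ⟨η, hη, s1, s2, s3⟩ := hk₁ (k₁ + (q+1) + 1) (by omega)
  have hC := b.e.Cpos
  classical
  have hex := h (k₁ + (q+1) + 1)
  obtain ⟨j1, j2, j3⟩ := Nat.find_spec hex
  have hmin := fun m hm => Nat.find_min hex (m := m) hm
  generalize Nat.find hex = j at *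
  have hj : 1 < j := by
    rcases Nat.lt_or_ge 1 j with h | h
    · exact h
    · have : j = 1 := by omega
      subst this; exact absurd rfl j3
  obtain ⟨j', a1, a2, a3, a4⟩ := b.e.prevocc hj
  have a5 : dd F H (E^[k₁ + (q+1) + 1] j') = dd F H (E^[k₁ + (q+1) + 1] 1) := by
    by_contra hc
    exact hmin j' a2 ⟨a1, a4, hc⟩
  have L0 : ∀ i, 1 ≤ i → E^[k₁] i + 2 * 4 * η ≤ E^[k₁] (i+1) := by
    intro i hi
    have x1 := b.e.lenshift k₁ (q+2) i
    have x2 := s1 i hi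
    have x3 : E^[k₁] i < E^[k₁] (i+1) := (b.e.cpt.iter k₁).sm (Nat.lt_succ_self i)
    rw [show k₁ + (q+2) = k₁ + (q+1) + 1 by ring] at x1
    have x4 : C^(q+2) * (2 * 4 * η) ≤ C^(q+2) * (E^[k₁] (i+1) - E^[k₁] i) := by
      have : 2 * 4 * C^(q+2) * η = C^(q+2) * (2 * 4 * η) := by ring
      omega
    have := Nat.le_of_mul_le_mul_left x4 (by positivity)
    omega
  have L1 : ∀ i, 1 ≤ i → E^[k₁+(q+1)] i + 4 * (2 * η) ≤ E^[k₁+(q+1)] (i+1) := by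
    intro i hi
    rw [Function.iterate_add_apply E k₁ (q+1) i, Function.iterate_add_apply E k₁ (q+1) (i+1)]
    have x1 := L0 (E^[q+1] i) (b.e.itge _ hi)
    have x2 : E^[q+1] i + 1 ≤ E^[q+1] (i+1) := (b.e.cpt.iter (q+1)).sm (Nat.lt_succ_self i)
    have x3 := (b.e.cpt.iter k₁).sm.monotone x2
    omega
  have s2' := s2 1 le_rfl (by omega)
  have s3' := s3 j' a1 (j - j') (by omega)
  rw [show j' + (j - j') = j by omega, a5] at s3'
  obtain ⟨p, m, p1, p2, p3, p4⟩ := b.stretch (k' := k₁ + (q+1)) (j := j) (j' := 1) (η := 2 * η)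
    j1 j2 (by rw [abs_le] at *; push_cast; constructor <;> omega)
    (by push_cast; have : (0:ℤ) ≤ η := by positivity
        linarith)
    (by have := s3 j j1 1 (by omega); push_cast; have : (0:ℤ) ≤ η := by positivity
        linarith) j3 L1
  exact ⟨p, p1, b.e.uniform hq p3 p4 (fun i hi => by have := L0 i hi; omega)⟩

end Big

lemma Cpt.addle {s : ℕ → X} {F : ℕ → ℕ} (h : Cpt s F) (a m : ℕ) : F a + m ≤ F (a + m) := by
  induction m with
  | zero => simp
  | succ m ih =>
    have : F (a + m) < F (a + m + 1) := h.sm (Nat.lt_succ_self _)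
    show F a + (m + 1) ≤ F (a + m + 1)
    omega

namespace Big

variable {s : ℕ → X} {F H E T : ℕ → ℕ} {C : ℕ}

lemma perd1 (b : Big s F H E T C) {A B p : ℕ} (h : Per s A B p) {u : ℕ} (hA : A ≤ u)
    (hB : u + p ≤ B) : dd F H (u + p) - dd F H u = dd F H (A + p) - dd F H A := by
  induction u, hA using Nat.le_induction with
  | base => rfl
  | succ u hu ih =>
    have i1 := ih (by omega)
    have i2 := b.letter (h u hu (by omega))
    rw [show u + 1 + p = u + p + 1 by omega]
    linarith

lemma perdt (b : Big s F H E T C) {A B p : ℕ} (h : Per s A B p) (t : ℕ)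
    (hB : A + t * p ≤ B) :
    dd F H (A + t * p) - dd F H A = t * (dd F H (A + p) - dd F H A) := by
  induction t with
  | zero => simp
  | succ t ih =>
    have e : (t+1) * p = t * p + p := by ring
    rw [e] at hB ⊢
    have i1 := ih (by omega)
    have i2 := b.perd1 h (u := A + t * p) (by omega) (by omega)
    rw [← add_assoc]
    push_cast
    linarith

lemma perd0 (b : Big s F H E T C) {A B p : ℕ} (hp : 0 < p) (h : Per s A B p)
    (h0 : dd F H (A + p) = dd F H A) (i : ℕ) (hA : A ≤ i) (hB : i ≤ B) :
    |dd F H i - dd F H A| ≤ C * p := by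
  induction i using Nat.strong_induction_on with
  | _ i ih =>
    by_cases hi : i < A + p
    · have := b.lip A (i - A)
      rw [Nat.add_sub_cancel' hA] at this
      refine this.trans (mul_le_mul_of_nonneg_left ?_ (by positivity))
      exact_mod_cast (by omega : i - A ≤ p)
    · have i1 := ih (i - p) (by omega) (by omega) (by omega)
      have i2 := b.perd1 h (u := i - p) (by omega) (by omega)
      rw [show i - p + p = i by omega, h0] at i2
      rw [show dd F H i = dd F H (i - p) by linarith]
      exact i1

lemma lens (b : Big s F H E T C) (L : ℕ) :
    ∃ n0, ∀ n, n0 ≤ n → ∀ j, 1 ≤ j → E^[n] j + L ≤ E^[n] (j+1) := by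
  obtain ⟨n0, h⟩ := b.small L 0
  refine ⟨n0, fun n hn j hj => ?_⟩
  obtain ⟨η, h1, h2, -⟩ := h n hn
  have := h2 j hj
  have : L * 1 ≤ L * η := Nat.mul_le_mul_left _ h1
  omega

lemma lemC (b : Big s F H E T C) {p : ℕ} (hp : 0 < p)
    (h : ∀ n j, 1 ≤ j → Per s (E^[n] j) (E^[n] (j+1)) p) :
    ∃ n0, ∀ n, n0 ≤ n → ∀ j, 1 ≤ j → dd F H (E^[n] j + p) = dd F H (E^[n] j) := by
  obtain ⟨n0, hs⟩ := b.small (p * (C * p + 3)) 1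
  refine ⟨n0, fun n hn j hj => ?_⟩
  obtain ⟨η, h1, h2, -, h3⟩ := hs n hn
  have l := h2 j hj
  have d := h3 j hj 1 le_rfl
  by_contra hc
  set A := E^[n] j
  set B := E^[n] (j+1)
  have hAB : p * ((C * p + 3) * η) ≤ B - A := by rw [← mul_assoc]; omega
  have ht : (C * p + 3) * η ≤ (B - A) / p := by
    rw [Nat.le_div_iff_mul_le hp]; rw [mul_comm]; exact hAB
  have hm := Nat.div_add_mod (B - A) p
  have hm2 := Nat.mod_lt (B - A) hp
  set t := (B - A) / p
  set r := (B - A) % p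
  rw [mul_comm] at hm
  have k1 := b.perdt (h n j hj) t (by omega)
  have k2 := b.lip (A + t * p) r
  rw [show A + t * p + r = B by omega] at k2
  have k3 : (C:ℤ) * r ≤ C * p := mul_le_mul_of_nonneg_left (by exact_mod_cast hm2.le) (by positivity)
  have k4 : |(t:ℤ) * (dd F H (A + p) - dd F H A)| ≤ η + C * p := by
    rw [← k1]
    rw [abs_le] at *
    constructor <;> linarith
  rw [abs_mul, abs_of_nonneg (by positivity : (0:ℤ) ≤ t)] at k4
  have k5 : 1 ≤ |dd F H (A + p) - dd F H A| := Int.one_le_abs (sub_ne_zero.mpr hc)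
  have k6 : (t:ℤ) * 1 ≤ t * |dd F H (A + p) - dd F H A| :=
    mul_le_mul_of_nonneg_left k5 (by positivity)
  have k7 : (C * p + 3) * η ≤ η + C * p := by
    have : (t:ℤ) ≤ η + C * p := by linarith
    have : t ≤ η + C * p := by exact_mod_cast this
    omega
  have k8 : (C * p) * 1 ≤ (C * p) * η := Nat.mul_le_mul_left _ h1
  rw [add_mul] at k7
  omega

/-- image of a periodic word glued along a cut point -/
lemma imgGlue {G : ℕ → ℕ} (cG : Cpt s G) (bG : ∀ i, G (i+1) ≤ G i + C) {A M B p : ℕ}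
    (hAB : Per s A B p) (hAM : A + p ≤ M) (hMB : M + p ≤ B)
    (hl : Per s (G A) (G M) p) (hr : Per s (G M) (G B) p)
    (hL : G A + (C+1) * p ≤ G M) : Per s (G A) (G B) p := by
  have h1 := cG.perImage hAB (by omega)
  have h2 := cG.addle A p
  have h3 := slope_le bG A p
  have h4 := cG.addle M (B - M)
  rw [show M + (B - M) = B by omega] at h4
  have : (C+1) * p = C * p + p := by ring
  exact hl.glue hr h1 (by omega) (by omega) (by omega) (by omega)

lemma mon (b : Big s F H E T C) {p n0 : ℕ}
    (h : ∀ n j, 1 ≤ j → Per s (E^[n] j) (E^[n] (j+1)) p)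
    (hL : ∀ n, n0 ≤ n → ∀ j, 1 ≤ j → E^[n] j + (C+1) * p ≤ E^[n] (j+1))
    {n j : ℕ} (hn : n0 ≤ n) (hj : 1 ≤ j) (hper : Per s (E^[n] j) (E^[n] (j+2)) p) :
    Per s (E^[n+1] j) (E^[n+1] (j+2)) p := by
  have l1 := hL n hn j hj
  have l2 := hL n hn (j+1) (by omega)
  have l3 := hL (n+1) (by omega) j hj
  have x1 := h (n+1) j hj
  have x2 := h (n+1) (j+1) (by omega)
  have : (C+1) * p = C * p + p := by ring
  simp only [Function.iterate_succ_apply'] at *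
  have e2 : E^[n] (j+1+1) = E^[n] (j+2) := rfl
  exact imgGlue b.e.cpt b.e.bd hper (by omega) (by omega : E^[n] (j+1) + p ≤ _) x1 x2 l3

lemma caseA (b : Big s F H E T C) {p n0 n : ℕ} (hp : 0 < p)
    (h : ∀ n j, 1 ≤ j → Per s (E^[n] j) (E^[n] (j+1)) p)
    (hL : ∀ n, n0 ≤ n → ∀ j, 1 ≤ j → E^[n] j + (C+1) * p ≤ E^[n] (j+1))
    (h0 : ∀ n, n0 ≤ n → ∀ j, 1 ≤ j → dd F H (E^[n] j + p) = dd F H (E^[n] j))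
    (hn : n0 ≤ n) (hA : ∀ j, 1 ≤ j → j + 1 ≤ E 1 → Per s (E^[n] j) (E^[n] (j+2)) p) :
    ∃ K : ℤ, ∀ n, |dd F H n| ≤ K := by
  have hA' : ∀ n', n ≤ n' → ∀ j, 1 ≤ j → j + 1 ≤ E 1 → Per s (E^[n'] j) (E^[n'] (j+2)) p := by
    intro n' hn'
    induction n', hn' using Nat.le_induction with
    | base => exact hA
    | succ n' hn' ih => exact fun j h1 h2 => b.mon h hL (by omega) h1 (ih j h1 h2)
  have all : ∀ j, 1 ≤ j → ∀ n', n ≤ n' → Per s (E^[n'] j) (E^[n'] (j+2)) p := by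
    intro j
    induction j using Nat.strong_induction_on with
    | _ j ih =>
      intro hj n' hn'
      by_cases hj1 : j + 1 ≤ E 1
      · exact hA' n' hn' j hj hj1
      · obtain ⟨c, c1, c2, c3⟩ := findBlock b.e.cpt.sm (show E 1 ≤ j by omega)
        have mm := (b.e.cpt.iter n').sm.monotone
        by_cases hc : j + 1 < E (c+1)
        · have := h (n'+1) c c1
          rw [Function.iterate_succ_apply, Function.iterate_succ_apply] at this
          exact this.sub (mm c2) (mm (by omega))
        · have hcj : c < j := by
            rcases Nat.lt_or_ge c j with h | h
            · exact h
            · have h5 := b.e.one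
              have h6 := b.e.cpt.addle 1 (c - 1)
              rw [show 1 + (c-1) = c by omega] at h6
              omega
          have := ih c hcj c1 (n'+1) (by omega)
          rw [Function.iterate_succ_apply, Function.iterate_succ_apply] at this
          have b2 := b.e.big (c+1) (by omega)
          exact this.sub (mm c2) (mm (by rw [show c + 2 = c + 1 + 1 by omega]; omega))
  have hh : (C+1) * p = C * p + p := by ring
  have cov : ∀ v, Per s (E^[n] 1) (E^[n] v) p := fun v => by
    apply glueBlocks (b.e.cpt.iter n).sm
    · intro c c1 _; exact h n c c1
    · intro c c1 _; exact all c c1 n le_rfl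
    · intro c c1 _; have := hL n hn c c1; omega
  apply b.bounded_of (N := E^[n] 1) (K := |dd F H (E^[n] 1)| + C * p)
  intro i hi
  have k := b.perd0 hp (cov i) (h0 n hn 1 le_rfl) i hi ((b.e.cpt.iter n).le i)
  have := abs_sub_abs_le_abs_sub (dd F H i) (dd F H (E^[n] 1))
  linarith

end Big

namespace Big

variable {s : ℕ → X} {F H E T : ℕ → ℕ} {C : ℕ}

lemma Fper (b : Big s F H E T C) {p : ℕ}
    (h : ∀ n j, 1 ≤ j → Per s (E^[n] j) (E^[n] (j+1)) p) (m j : ℕ) (hj : 1 ≤ j) :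
    Per s (F (E^[m] j)) (F (E^[m] (j+1))) p := by
  rw [b.commIter, b.commIter]
  obtain ⟨i, -, i2, i3, i4⟩ := b.p2 1 j le_rfl hj
  have x := h (m+1) 1 le_rfl
  rw [Function.iterate_succ_apply, Function.iterate_succ_apply] at x
  have mm := (b.e.cpt.iter m).sm.monotone
  exact ((b.e.cpt.iter m).comp b.cF).perLetter i4 (x.sub (mm i2) (mm i3))

lemma caseBclaim (b : Big s F H E T C) {p m η j : ℕ}
    (h : ∀ n j, 1 ≤ j → Per s (E^[n] j) (E^[n] (j+1)) p)
    (hL : ∀ i, 1 ≤ i → E^[m] i + ((C+1) * p + η) ≤ E^[m] (i+1))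
    (hL' : ∀ i, 1 ≤ i → E^[m+1] i + (C+1) * p ≤ E^[m+1] (i+1))
    (hj : 1 ≤ j) (d1 : |dd F H (E^[m] j)| ≤ η) (d2 : |dd F H (E^[m] (j+2))| ≤ η)
    (hB : ¬ Per s (E^[m+1] j) (E^[m+1] (j+2)) p) :
    |dd F H (E^[m] (j+1))| ≤ ((C+1) * p : ℕ) := by
  by_contra hc
  apply hB
  have fl := b.Fper h m j hj
  have fr := b.Fper h m (j+1) (by omega)
  have l1 := hL j hj
  have l2 := hL (j+1) (by omega)
  have l3 := hL' j hj
  have z := h m (j+1) (by omega)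
  have z0 := h m j hj
  have w1 := h (m+1) j hj
  have w2 := h (m+1) (j+1) (by omega)
  rw [show j + 1 + 1 = j + 2 by rfl] at l2 fr z w2
  have n1 := b.cF.addle (E^[m] j) (E^[m] (j+1) - E^[m] j)
  have n2 := b.cF.addle (E^[m] (j+1)) (E^[m] (j+2) - E^[m] (j+1))
  rw [Nat.add_sub_cancel' (by omega)] at n1 n2
  have hh : (C+1) * p = C * p + p := by ring
  simp only [Function.iterate_succ_apply'] at l3 w1 w2 ⊢
  generalize E^[m] j = x at *
  generalize E^[m] (j+1) = y at *
  generalize E^[m] (j+2) = v at *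
  have key : Per s (F x) (F v) p := by
    unfold dd at hc d1 d2
    rw [abs_le] at hc d1 d2
    by_cases hs : F y ≤ H y
    · have q1 := b.cH.perImage z0 (by omega)
      have q2 := b.cH.addle x p
      have q3 := slope_le b.bH x p
      exact fl.glue fr q1 (by omega) (by omega) (by omega) (by omega)
    · have q1 := b.cH.perImage z (by omega)
      have q2 := b.cH.addle y p
      have q3 := slope_le b.bH y p
      exact fl.glue fr q1 (by omega) (by omega) (by omega) (by omega)
  have := imgGlue b.cT b.bT key (by omega) (by omega : F y + p ≤ F v)
    (by rw [← b.ET, ← b.ET]; exact w1) (by rw [← b.ET, ← b.ET]; exact w2)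
    (by rw [← b.ET, ← b.ET]; exact l3)
  rwa [← b.ET, ← b.ET] at this

lemma steps (b : Big s F H E T C) {p m : ℕ} (hp : 0 < p)
    (h : ∀ n j, 1 ≤ j → Per s (E^[n] j) (E^[n] (j+1)) p)
    (h0 : ∀ j, 1 ≤ j → dd F H (E^[m] j + p) = dd F H (E^[m] j)) (r : ℕ) :
    |dd F H (E^[m] (1 + r)) - dd F H (E^[m] 1)| ≤ r * (C * p) := by
  induction r with
  | zero => simp
  | succ r ih =>
    have m1 : E^[m] (1 + r) ≤ E^[m] (1 + r + 1) := (b.e.cpt.iter m).sm.monotone (by omega)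
    have := b.perd0 hp (h m (1+r) (by omega)) (h0 (1+r) (by omega)) _ m1 le_rfl
    rw [← add_assoc]
    push_cast
    rw [abs_le] at *
    constructor <;> linarith

lemma caseB (b : Big s F H E T C) {p n0 : ℕ} (hp : 0 < p)
    (h : ∀ n j, 1 ≤ j → Per s (E^[n] j) (E^[n] (j+1)) p)
    (hL : ∀ n, n0 ≤ n → ∀ j, 1 ≤ j → E^[n] j + (C+1) * p ≤ E^[n] (j+1))
    (h0 : ∀ n, n0 ≤ n → ∀ j, 1 ≤ j → dd F H (E^[n] j + p) = dd F H (E^[n] j))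
    (hB : ∀ n, n0 ≤ n → ∃ j, 1 ≤ j ∧ j + 1 ≤ E 1 ∧ ¬ Per s (E^[n] j) (E^[n] (j+2)) p) :
    ∃ K : ℤ, ∀ n, |dd F H n| ≤ K := by
  obtain ⟨k₁, hk⟩ := b.small ((C+1) * p + 1) (E 1 + 1)
  set N := max n0 k₁
  have hQ : StrictMono (fun m => E^[m] 1) := by
    apply strictMono_nat_of_lt_succ
    intro m
    simp only [Function.iterate_succ_apply]
    exact (b.e.cpt.iter m).sm b.e.one
  apply b.bounded_of (N := E^[N] 1)
    (K := ((C+1) * p : ℕ) + E 1 * (C * p) + E 1 * (C * p) + C * p)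
  intro i hi
  obtain ⟨m, m1, m2, m3⟩ := findBlock hQ (u := N) hi
  simp only [Function.iterate_succ_apply] at m2 m3
  have hm0 : n0 ≤ m := (le_max_left _ _).trans m1
  obtain ⟨η, e1, e2, e3, -⟩ := hk m ((le_max_right _ _).trans m1)
  obtain ⟨j, j1, j2, j3⟩ := hB (m+1) (by omega)
  have c1 := b.caseBclaim h (η := η) (fun i hi => by
      have := e2 i hi
      have t1 : ((C+1)*p) * 1 ≤ ((C+1)*p) * η := Nat.mul_le_mul_left _ e1
      have t2 : ((C+1)*p + 1) * η = ((C+1)*p) * η + η := by ring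
      omega) (hL (m+1) (by omega)) j1 (e3 j j1 (by omega)) (e3 (j+2) (by omega) (by omega)) j3
  have c2 := b.steps hp h (h0 m hm0) j
  obtain ⟨c, x1, x2, x3⟩ := findBlock (b.e.cpt.iter m).sm m2
  have x4 : c < E 1 := by
    by_contra hc
    have := (b.e.cpt.iter m).sm.monotone (not_lt.mp hc)
    omega
  have c3 := b.steps hp h (h0 m hm0) (c - 1)
  have c4 := b.perd0 hp (h m c x1) (h0 m hm0 c x1) i x2 x3.le
  rw [add_comm 1 j] at c2
  rw [show 1 + (c - 1) = c by omega] at c3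
  have y1 : (j:ℤ) * (C * p) ≤ E 1 * (C * p) :=
    mul_le_mul_of_nonneg_right (by exact_mod_cast (by omega : j ≤ E 1)) (by positivity)
  have y2 : ((c - 1 : ℕ):ℤ) * (C * p) ≤ E 1 * (C * p) :=
    mul_le_mul_of_nonneg_right (by exact_mod_cast (by omega : c - 1 ≤ E 1)) (by positivity)
  rw [abs_le] at *
  constructor <;> linarith

theorem main [Finite X] (b : Big s F H E T C) : ∃ K : ℤ, ∀ n, |dd F H n| ≤ K := by
  by_cases hI : ∃ k, ∀ j, 1 ≤ j → s j = s 1 → dd F H (E^[k] j) = dd F H (E^[k] 1)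
  · obtain ⟨k, hk⟩ := hI
    exact b.caseI hk
  push Not at hI
  obtain ⟨p, hp, h⟩ := b.lemB hI
  obtain ⟨a1, h1⟩ := b.lens ((C+1) * p)
  obtain ⟨a2, h2⟩ := b.lemC hp h
  have hL := fun n (hn : max a1 a2 ≤ n) => h1 n ((le_max_left _ _).trans hn)
  have h0 := fun n (hn : max a1 a2 ≤ n) => h2 n ((le_max_right _ _).trans hn)
  by_cases hA : ∃ n, max a1 a2 ≤ n ∧
      ∀ j, 1 ≤ j → j + 1 ≤ E 1 → Per s (E^[n] j) (E^[n] (j+2)) p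
  · obtain ⟨n, hn, hA⟩ := hA
    exact b.caseA hp h hL h0 hn hA
  · push Not at hA
    exact b.caseB hp h hL h0 hA

end Big

theorem bridge [Finite X] {s : ℕ → X} {G₁ G₂ : ℕ → ℕ} (c1 : Cpt s G₁) (c2 : Cpt s G₂) {k : ℕ}
    (hprim : ∀ j j', 1 ≤ j → 1 ≤ j' →
      ∃ i, (G₁ ∘ G₂)^[k] j ≤ i ∧ i < (G₁ ∘ G₂)^[k] (j+1) ∧ s i = s j')
    (hone : 2 ≤ G₁ 1) : ∃ K : ℤ, ∀ n, |dd (G₁ ∘ G₂) (G₂ ∘ G₁) n| ≤ K := by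
  by_cases hdeg : ∀ j, 1 ≤ j → s j = s 1
  · have lin : ∀ G : ℕ → ℕ, Cpt s G → ∃ c, ∀ n m, 1 ≤ n → G (n + m) = G n + c * m := by
      intro G hG
      refine ⟨G 2 - G 1, fun n m hn => ?_⟩
      induction m with
      | zero => simp
      | succ m ih =>
        have a := hG.len (n + m) 1 (hdeg _ (by omega))
        have b : G 1 < G 2 := hG.sm (by omega)
        rw [← add_assoc, mul_add]
        simp only [Nat.reduceAdd] at a
        omega
    obtain ⟨a1, h1⟩ := lin G₁ c1
    obtain ⟨a2, h2⟩ := lin G₂ c2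
    refine ⟨|dd (G₁ ∘ G₂) (G₂ ∘ G₁) 1|, fun n => ?_⟩
    rcases Nat.eq_zero_or_pos n with rfl | hn
    · have : dd (G₁ ∘ G₂) (G₂ ∘ G₁) 0 = 0 := by
        simp [dd, c1.zero, c2.zero]
      rw [this]; simp
    · apply le_of_eq
      congr 1
      obtain ⟨m, rfl⟩ : ∃ m, n = 1 + m := ⟨n - 1, by omega⟩
      simp only [dd, Function.comp_apply]
      rw [h2 1 m le_rfl, h1 1 m le_rfl, h1 _ _ (c2.le 1), h2 _ _ (c1.le 1)]
      push_cast; ring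
  push Not at hdeg
  obtain ⟨j0, hj0, hne⟩ := hdeg
  have cF := c1.comp c2
  have cH := c2.comp c1
  have hlit := fun (E : ℕ → ℕ) (C : ℕ) (h : ESys s E C) => two_fun_little h c1 c2
  have hF1 : 2 ≤ (G₁ ∘ G₂) 1 := hone.trans (c1.sm.monotone (c2.le 1))
  have hdef : ∀ n, dd (G₁ ∘ G₂) (G₂ ∘ G₁) n = (G₁ (G₂ n) : ℤ) - G₂ (G₁ n) := fun n => rfl
  generalize hF : G₁ ∘ G₂ = F at *
  generalize hH : G₂ ∘ G₁ = H at *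
  have cA := cF.iter k
  have A2 : ∀ j, 1 ≤ j → F^[k] j + 2 ≤ F^[k] (j+1) := by
    intro j hj
    obtain ⟨i, i1, i2, i3⟩ := hprim j j0 hj hj0
    obtain ⟨i', i1', i2', i3'⟩ := hprim j 1 hj le_rfl
    have : i ≠ i' := by
      rintro rfl
      exact hne (i3.symm.trans i3')
    omega
  have cT := cF.iter (k + k)
  have cE := cF.iter (k + k + 1)
  have hT : ∀ n, F^[k+k] n = F^[k] (F^[k] n) := fun n => Function.iterate_add_apply F k k n
  have T4 : ∀ j, 1 ≤ j → F^[k+k] j + 4 ≤ F^[k+k] (j+1) := by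
    intro j hj
    rw [hT, hT]
    have a := A2 j hj
    have hk := hj.trans (cA.le j)
    have b1 := A2 (F^[k] j) hk
    have b2 := A2 (F^[k] j + 1) (by omega)
    have b3 : F^[k] (F^[k] j + 1 + 1) ≤ F^[k] (F^[k] (j+1)) := cA.sm.monotone (by omega)
    omega
  have Tall : ∀ j j', 1 ≤ j → 1 ≤ j' →
      ∃ i, F^[k+k] j ≤ i ∧ i < F^[k+k] (j+1) ∧ s i = s j' := by
    intro j j' hj hj'
    obtain ⟨i, i1, i2, i3⟩ := hprim (F^[k] j) j' (hj.trans (cA.le j)) hj'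
    refine ⟨i, by rw [hT]; exact i1, ?_, i3⟩
    rw [hT]
    exact i2.trans_le (cA.sm.monotone (cA.sm (Nat.lt_succ_self j)))
  have ET : ∀ n, F^[k+k+1] n = F^[k+k] (F n) := fun n => Function.iterate_succ_apply F _ n
  have ET' : ∀ n, F^[k+k+1] n = F (F^[k+k] n) := fun n => Function.iterate_succ_apply' F _ n
  have hFs : ∀ j, F j + 1 ≤ F (j+1) := fun j => cF.sm (Nat.lt_succ_self j)
  obtain ⟨C1, b1⟩ := cF.bdd
  obtain ⟨C2, b2⟩ := cH.bdd
  obtain ⟨C3, b3⟩ := cT.bdd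
  obtain ⟨C4, b4⟩ := cE.bdd
  have hE : ESys s (F^[k+k+1]) (C1 + C2 + C3 + C4) :=
    { cpt := cE
      bd := fun i => (b4 i).trans (by omega)
      big := by
        intro j hj
        rw [ET, ET]
        have x := T4 (F j) (hj.trans (cF.le j))
        have y := cT.sm.monotone (hFs j)
        omega
      all := by
        intro j j' hj hj'
        obtain ⟨i, i1, i2, i3⟩ := Tall (F j) j' (hj.trans (cF.le j)) hj'
        refine ⟨i, by rw [ET]; exact i1, ?_, i3⟩
        rw [ET]
        exact i2.trans_le (cT.sm.monotone (hFs j))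
      one := by
        rw [ET]
        exact hF1.trans (cT.le _) }
  have hB : Big s F H (F^[k+k+1]) (F^[k+k]) (C1 + C2 + C3 + C4) :=
    { e := hE
      cF := cF
      cH := cH
      cT := cT
      bF := fun i => (b1 i).trans (by omega)
      bH := fun i => (b2 i).trans (by omega)
      bT := fun i => (b3 i).trans (by omega)
      comm := fun n => (Function.iterate_succ_apply' F _ n).symm.trans
        (Function.iterate_succ_apply F _ n)
      ET := ET
      p2 := by
        intro j j' hj hj'
        obtain ⟨i, i1, i2, i3⟩ := Tall j j' hj hj'
        refine ⟨i, (hj.trans (cT.le j)).trans i1, ?_, ?_, i3⟩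
        · rw [ET']; exact cF.sm.monotone i1
        · rw [ET']; exact cF.sm.monotone i2
      small := by
        intro M J
        refine small_gen hE (d := dd F H) ?_ ?_ M J
        · intro i j e
          have x1 := cF.len i j e
          have x2 := cH.len i j e
          have : dd F H (i+1) - dd F H i = dd F H (j+1) - dd F H j := by unfold dd; omega
          beta_reduce
          exact_mod_cast this
        · intro ε hε
          obtain ⟨K, hK, h⟩ := hlit _ _ hE ε hε
          refine ⟨K, hK, fun n => ?_⟩
          have := h n
          rw [← hdef] at this
          exact this }
  exact hB.main

/-! ### Concrete words -/

def pre (s : ℕ → X) (n : ℕ) : List X := (List.range n).map s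

lemma pre_len (s : ℕ → X) (n : ℕ) : (pre s n).length = n := by simp [pre]

lemma pre_succ (s : ℕ → X) (n : ℕ) : pre s (n+1) = pre s n ++ [s n] := by
  simp [pre, List.range_succ]

lemma pre_get (s : ℕ → X) {n i : ℕ} (h : i < n) : (pre s n)[i]? = some (s i) := by
  simp [pre, h]

lemma pre_prefix (s : ℕ → X) {m n : ℕ} (h : m ≤ n) : pre s m <+: pre s n := by
  induction n, h using Nat.le_induction with
  | base => exact List.prefix_refl _
  | succ n hn ih => rw [pre_succ]; exact ih.trans (List.prefix_append _ _)

lemma IsPrefI.eq_pre {s : ℕ → X} {w : List X} (h : IsPrefI w s) : w = pre s w.length := by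
  apply List.ext_getElem
  · rw [pre_len]
  · intro i h1 h2
    rw [h i h1]
    simp [pre]

lemma prefix_eq_pre {s : ℕ → X} {u w : List X} (h : u <+: w) (hw : IsPrefI w s) :
    u = pre s u.length := by
  apply IsPrefI.eq_pre
  intro i hi
  rw [h.getElem hi]
  exact hw i _

lemma applyM_append (g : X → List X) (u v : List X) :
    applyM g (u ++ v) = applyM g u ++ applyM g v := by simp [applyM]

lemma iterM_append (g : X → List X) (k : ℕ) (u v : List X) :
    iterM g k (u ++ v) = iterM g k u ++ iterM g k v := by
  induction k generalizing u v with
  | zero => rfl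
  | succ k ih =>
    have := ih (applyM g u) (applyM g v)
    rw [← applyM_append] at this
    exact this

lemma iterM_nil (g : X → List X) (k : ℕ) : iterM g k [] = [] := by
  induction k with
  | zero => rfl
  | succ k ih => exact ih

lemma applyM_comp (g h : X → List X) (w : List X) :
    applyM (compM g h) w = applyM g (applyM h w) := by
  simp only [applyM, List.flatMap_assoc]
  rfl

def Gl (g : X → List X) (s : ℕ → X) (n : ℕ) : ℕ := (applyM g (pre s n)).length

lemma applyM_pre {g : X → List X} {a : X} {s : ℕ → X} (h : IsOmega g a s) (n : ℕ) :
    applyM g (pre s n) = pre s (Gl g s n) := by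
  obtain ⟨i, hi⟩ := (h.1.2.eventually_ge_atTop n).exists
  have h1 := (h.2 i).eq_pre
  have h2 : pre s n <+: iterM g i [a] := by rw [h1]; exact pre_prefix s hi
  obtain ⟨t, ht⟩ := h2
  have h3 : applyM g (pre s n) <+: iterM g (i+1) [a] := by
    refine ⟨applyM g t, ?_⟩
    rw [← applyM_append, ht]
    simp only [iterM]
    rw [Function.iterate_succ_apply']
  exact prefix_eq_pre h3 (h.2 (i+1))

lemma Gl_succ (g : X → List X) (s : ℕ → X) (n : ℕ) :
    Gl g s (n+1) = Gl g s n + (g (s n)).length := by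
  unfold Gl
  rw [pre_succ, applyM_append, List.length_append]
  simp [applyM]

lemma get_of_pre {s : ℕ → X} {m n : ℕ} {w : List X} (h : pre s n = pre s m ++ w) {r : ℕ}
    (hr : r < w.length) : w[r]? = some (s (m + r)) := by
  have hl := congrArg List.length h
  rw [List.length_append, pre_len, pre_len] at hl
  have h1 := pre_get s (show m + r < n by omega)
  rw [h, List.getElem?_append_right (by rw [pre_len]; omega), pre_len,
    Nat.add_sub_cancel_left] at h1
  exact h1

lemma Gl_cpt {g : X → List X} {a : X} {s : ℕ → X} (h : IsOmega g a s)
    (hne : ∀ x, g x ≠ []) : Cpt s (Gl g s) where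
  sm := by
    apply strictMono_nat_of_lt_succ
    intro n
    rw [Gl_succ]
    have := List.length_pos_of_ne_nil (hne (s n))
    omega
  zero := by simp [Gl, pre, applyM]
  len := by
    intro i j e
    rw [Gl_succ, Gl_succ, e]; omega
  con := by
    have key : ∀ n, pre s (Gl g s (n+1)) = pre s (Gl g s n) ++ g (s n) := by
      intro n
      rw [← applyM_pre h, ← applyM_pre h, pre_succ, applyM_append]
      simp [applyM]
    intro i j r e hr
    rw [Gl_succ] at hr
    have x1 := get_of_pre (key i) (r := r) (by omega)
    have x2 := get_of_pre (key j) (r := r) (by rw [← e]; omega)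
    rw [e, x2] at x1
    exact (Option.some_injective _ x1).symm

lemma nonerasing {g f : X → List X} {a : X} (ha : g a ≠ []) (h : OneSimple (compM f g) a) (x : X) :
    g x ≠ [] := by
  by_cases hx : x = a
  · rw [hx]; exact ha
  obtain ⟨k, hk, hh⟩ := h
  intro hg
  have := hh x x hx hx
  obtain ⟨k, rfl⟩ : ∃ m, k = m + 1 := ⟨k - 1, by omega⟩
  have e : iterM (compM f g) (k+1) [x] = iterM (compM f g) k [] := by
    simp only [iterM]
    rw [Function.iterate_succ_apply]
    congr 1
    simp [applyM, compM, hg]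
  rw [e, iterM_nil] at this
  simp at this

lemma s_zero {g : X → List X} {a : X} {s : ℕ → X} (h : IsOmega g a s) : s 0 = a := by
  have := h.2 0 0 (by simp [iterM])
  rw [← this]
  simp [iterM]

lemma s_ne {g : X → List X} {a : X} {s : ℕ → X} (h : OneSystem g a s) {j : ℕ} (hj : 1 ≤ j) :
    s j ≠ a := by
  obtain ⟨⟨w, hw, haw⟩, h2, -, ho, -⟩ := h
  have key : ∀ i, ∃ v, iterM g i [a] = a :: v ∧ a ∉ v := by
    intro i
    induction i with
    | zero => exact ⟨[], rfl, by simp⟩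
    | succ i ih =>
      obtain ⟨v, hv, hav⟩ := ih
      refine ⟨w ++ applyM g v, ?_, ?_⟩
      · simp only [iterM] at hv ⊢
        rw [Function.iterate_succ_apply', hv]
        simp [applyM, hw]
      · simp only [List.mem_append, applyM, List.mem_flatMap, not_or, not_exists, not_and]
        refine ⟨haw, fun x hx => h2 x ?_⟩
        rintro rfl
        exact hav hx
  obtain ⟨i, hi⟩ := (ho.1.2.eventually_gt_atTop j).exists
  obtain ⟨v, hv, hav⟩ := key i
  have x := ho.2 i j hi
  intro hs
  apply hav
  obtain ⟨j, rfl⟩ : ∃ m, j = m + 1 := ⟨j - 1, by omega⟩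
  rw [← hs, ← x]
  simp only [hv, List.getElem_cons_succ]
  exact List.getElem_mem _

lemma Gl_one {g : X → List X} {a : X} {s : ℕ → X} (h : OneSystem g a s) : 2 ≤ Gl g s 1 := by
  obtain ⟨⟨w, hw, haw⟩, h2, hinf, ho, -⟩ := h
  have h0 : Gl g s 0 = 0 := by simp [Gl, pre, applyM]
  have := Gl_succ g s 0
  rw [h0, s_zero ho, hw] at this
  rw [this]
  rcases w with _ | ⟨x, w⟩
  · exfalso
    apply hinf
    apply (Set.finite_singleton [a]).subset
    rintro _ ⟨i, rfl⟩
    induction i with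
    | zero => simp [iterM]
    | succ i ih =>
      simp only [Set.mem_singleton_iff, iterM] at ih ⊢
      rw [Function.iterate_succ_apply', ih]
      simp [applyM, hw]
  · simp

lemma iterM_pre {g₁ g₂ : X → List X} {a : X} {s : ℕ → X} (h₁ : IsOmega g₁ a s)
    (h₂ : IsOmega g₂ a s) (k n : ℕ) :
    iterM (compM g₁ g₂) k (pre s n) = pre s ((Gl g₁ s ∘ Gl g₂ s)^[k] n) := by
  induction k generalizing n with
  | zero => rfl
  | succ k ih =>
    simp only [iterM] at ih ⊢
    rw [Function.iterate_succ_apply, Function.iterate_succ_apply, applyM_comp, applyM_pre h₂,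
      applyM_pre h₁, ih]
    rfl

/-- If `(X,g₁,a)` and `(X,g₂,a)` are 1-systems with
`g₁^ω(a) = g₂^ω(a)` and `(X,g₁g₂,a)`, `(X,g₂g₁,a)` are 1-simple, then there is
`K ≥ 1` with `||g₁g₂(w)| - |g₂g₁(w)|| ≤ K` for every prefix `w` of `g₁^ω(a)`. -/
theorem one_system_balance {X : Type*}
    (g₁ g₂ : X → List X) (a : X) (s : ℕ → X)
    (h₁ : OneSystem g₁ a s) (h₂ : OneSystem g₂ a s)
    (hs₁ : OneSimple (compM g₁ g₂) a) (hs₂ : OneSimple (compM g₂ g₁) a) :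
    ∃ K : ℕ, 0 < K ∧ ∀ w : List X, IsPrefI w s →
      (((applyM g₁ (applyM g₂ w)).length : ℤ) -
        ((applyM g₂ (applyM g₁ w)).length : ℤ)).natAbs ≤ K := by
  obtain ⟨k, hk, hkk⟩ := hs₁
  have o₁ := h₁.2.2.2.1
  have o₂ := h₂.2.2.2.1
  have n₁ : ∀ x, g₁ x ≠ [] := nonerasing (by
    obtain ⟨⟨w, hw, -⟩, -⟩ := h₁
    rw [hw]; simp) hs₂
  have n₂ : ∀ x, g₂ x ≠ [] := nonerasing (by
    obtain ⟨⟨w, hw, -⟩, -⟩ := h₂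
    rw [hw]; simp) (⟨k, hk, hkk⟩ : OneSimple (compM g₁ g₂) a)
  have fin : Finite X := by
    have : (Set.univ : Set X) ⊆ insert a {x | x ∈ iterM (compM g₁ g₂) k [s 1]} := by
      intro x _
      by_cases hx : x = a
      · exact Or.inl hx
      · exact Or.inr (hkk x (s 1) hx (s_ne h₁ le_rfl))
    exact Set.finite_univ_iff.mp (((List.finite_toSet _).insert a).subset this)
  have c₁ := Gl_cpt o₁ n₁
  have c₂ := Gl_cpt o₂ n₂
  obtain ⟨K, hK⟩ := bridge c₁ c₂ (k := k) (by
    intro j j' hj hj'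
    have mem := hkk (s j') (s j) (s_ne h₁ hj') (s_ne h₁ hj)
    have e : pre s ((Gl g₁ s ∘ Gl g₂ s)^[k] (j+1)) =
        pre s ((Gl g₁ s ∘ Gl g₂ s)^[k] j) ++ iterM (compM g₁ g₂) k [s j] := by
      rw [← iterM_pre o₁ o₂, ← iterM_pre o₁ o₂, pre_succ, iterM_append]
    obtain ⟨r, hr, hr'⟩ := List.getElem_of_mem mem
    have g := get_of_pre e hr
    have hl := congrArg List.length e
    rw [List.length_append, pre_len, pre_len] at hl
    rw [List.getElem?_eq_getElem hr, hr'] at g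
    exact ⟨_, Nat.le_add_right _ r, by omega, (Option.some_injective _ g).symm⟩) (Gl_one h₁)
  refine ⟨K.natAbs + 1, by omega, fun w hw => ?_⟩
  have b := hK w.length
  rw [hw.eq_pre, applyM_pre o₂, applyM_pre o₁, applyM_pre o₁, applyM_pre o₂, pre_len, pre_len]
  simp only [dd, Function.comp_apply] at b
  rw [abs_le] at b
  omega
end
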